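/- arXiv:1305.0384 — 6 statements merged into one kernel-verified Lean document; each statement's English description precedes it below -/
import Mathlib

section
/- (Lemma 1, part (ii): lim_{M→∞} \bar S_M = conv(S_1).) (a) For every frame size M ≥ 1 and every binary multi-slot power allocation p (i.e., p_{im} ∈ {0,P_max} for all i,m), the frame rate vector R(p) lies in the convex hull conv(S_1) of the schedule set. (b) Conversely, for every R ∈ conv(S_1) and every ε > 0, there exists M_0 such that for every M ≥ M_0 there exists a binary multi-slot power allocation p satisfying R_i(p) ≥ R_i − ε for every link i. -/
open Finset

/-- Single-slot rate on link `i`: `r_i(p) = f(g_{ii} p_i / (N_0 + Σ_{j≠i} g_{ji} p_j))`. -/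
noncomputable def singleRate {N : ℕ} (f : ℝ → ℝ) (g : Fin N → Fin N → ℝ) (N0 : ℝ)
    (p : Fin N → ℝ) (i : Fin N) : ℝ :=
  f (g i i * p i / (N0 + ∑ j ∈ univ \ {i}, g j i * p j))

/-- Frame rate on link `i` for an `M`-slot power allocation. -/
noncomputable def frameRate {N M : ℕ} (f : ℝ → ℝ) (g : Fin N → Fin N → ℝ) (N0 : ℝ)
    (p : Fin N → Fin M → ℝ) (i : Fin N) : ℝ :=
  (1 / (M : ℝ)) * ∑ m, f (g i i * p i m / (N0 + ∑ j ∈ univ \ {i}, g j i * p j m))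

theorem frameRate_eq_mul_sum_singleRate {N M : ℕ} (f : ℝ → ℝ) (g : Fin N → Fin N → ℝ) (N0 : ℝ)
    (p : Fin N → Fin M → ℝ) (i : Fin N) :
    frameRate f g N0 p i = (1 / (M : ℝ)) * ∑ m, singleRate f g N0 (fun j => p j m) i :=
  rfl

/-- Given nonnegative weights `w` of total mass one and points `q k`, there are `M` points, each of
them some `q k` or a default `d`, among which every `q k` is used at least `⌊w k * M⌋` times. -/
theorem exists_sequence_sum_floor_mul_le {ι α : Type*} [Fintype ι] (w : ι → ℝ)
    (hw : ∀ k, 0 ≤ w k) (hw1 : ∑ k, w k = 1) (q : ι → α) (d : α) (M : ℕ) :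
    ∃ s : Fin M → α, (∀ m, s m = d ∨ ∃ k, s m = q k) ∧
      ∀ F : α → ℝ, (∀ m, 0 ≤ F (s m)) →
        ∑ k, (⌊w k * M⌋₊ : ℝ) * F (q k) ≤ ∑ m, F (s m) := by
  have hcard : Fintype.card (Σ k, Fin ⌊w k * M⌋₊) ≤ Fintype.card (Fin M) := by
    rw [Fintype.card_sigma]
    simp only [Fintype.card_fin]
    have h : ∑ k, (⌊w k * M⌋₊ : ℝ) ≤ ∑ k, w k * M :=
      Finset.sum_le_sum fun k _ => Nat.floor_le (mul_nonneg (hw k) M.cast_nonneg)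
    rw [← Finset.sum_mul, hw1, one_mul] at h
    exact_mod_cast h
  obtain ⟨e⟩ := Function.Embedding.nonempty_of_card_le hcard
  refine ⟨Function.extend e (fun x => q x.1) (fun _ => d), fun m => ?_, fun F hF => ?_⟩
  · by_cases h : ∃ x, e x = m
    · obtain ⟨x, rfl⟩ := h
      exact Or.inr ⟨x.1, e.injective.extend_apply _ _ _⟩
    · exact Or.inl (Function.extend_apply' _ _ _ h)
  · calc ∑ k, (⌊w k * M⌋₊ : ℝ) * F (q k)
        = ∑ x : Σ k, Fin ⌊w k * M⌋₊, F (q x.1) := by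
          simp [Fintype.sum_sigma]
      _ = ∑ m ∈ univ.map e, F (Function.extend e (fun x => q x.1) (fun _ => d) m) := by
          simp [Finset.sum_map, e.injective.extend_apply]
      _ ≤ ∑ m, F (Function.extend e (fun x => q x.1) (fun _ => d) m) :=
          Finset.sum_le_univ_sum_of_nonneg hF

theorem singleRate_nonneg {N : ℕ} {f : ℝ → ℝ} {g : Fin N → Fin N → ℝ} {N0 : ℝ}
    (hg : ∀ i j, 0 < g i j) (hN0 : 0 < N0) (hf : ∀ x ∈ Set.Ici (0 : ℝ), 0 ≤ f x)
    {q : Fin N → ℝ} (hq : ∀ i, 0 ≤ q i) (i : Fin N) : 0 ≤ singleRate f g N0 q i :=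
  hf _ <| div_nonneg (mul_nonneg (hg i i).le (hq i)) <|
    add_nonneg hN0.le <| Finset.sum_nonneg fun j _ => mul_nonneg (hg j i).le (hq j)

/-- Lemma 1, part (ii): `lim_{M→∞} \bar S_M = conv(S_1)`.
(a) every binary multi-slot rate vector lies in the convex hull of the schedule
set `S_1`; (b) every point of `conv(S_1)` is approached, up to any `ε > 0` and
coordinatewise from below, by binary multi-slot rate vectors, for all large
enough frame sizes `M`. -/
theorem multislot_schedule_region_eq_convex_hull
    {N : ℕ} (f : ℝ → ℝ) (g : Fin N → Fin N → ℝ) (N0 Pmax : ℝ)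
    (hg : ∀ i j, 0 < g i j) (hN0 : 0 < N0) (hP : 0 < Pmax)
    (hf_cont : ContinuousOn f (Set.Ici 0)) (hf_mono : MonotoneOn f (Set.Ici 0))
    (hf_conc : ConcaveOn ℝ (Set.Ici 0) f) (hf0 : f 0 = 0)
    (hf_nonneg : ∀ x ∈ Set.Ici (0 : ℝ), 0 ≤ f x) :
    (∀ M : ℕ, 1 ≤ M → ∀ p : Fin N → Fin M → ℝ,
      (∀ i m, p i m ∈ ({0, Pmax} : Set ℝ)) →
      frameRate f g N0 p ∈
        convexHull ℝ {r : Fin N → ℝ | ∃ q : Fin N → ℝ,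
          (∀ i, q i ∈ ({0, Pmax} : Set ℝ)) ∧ r = singleRate f g N0 q})
    ∧
    (∀ R ∈ convexHull ℝ {r : Fin N → ℝ | ∃ q : Fin N → ℝ,
        (∀ i, q i ∈ ({0, Pmax} : Set ℝ)) ∧ r = singleRate f g N0 q},
      ∀ ε : ℝ, 0 < ε → ∃ M0 : ℕ, 1 ≤ M0 ∧ ∀ M : ℕ, M0 ≤ M →
        ∃ p : Fin N → Fin M → ℝ,
          (∀ i m, p i m ∈ ({0, Pmax} : Set ℝ)) ∧
          ∀ i, R i - ε ≤ frameRate f g N0 p i) := by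
  have binary_nonneg : ∀ x ∈ ({0, Pmax} : Set ℝ), 0 ≤ x := by
    rintro x (rfl | rfl)
    exacts [le_rfl, hP.le]
  constructor
  · intro M hM p hp
    have hM0 : (M : ℝ) ≠ 0 := by positivity
    have h : frameRate f g N0 p =
        ∑ m : Fin M, (1 / (M : ℝ)) • singleRate f g N0 (fun j => p j m) := by
      ext i
      simp [frameRate_eq_mul_sum_singleRate, Finset.mul_sum]
    rw [h]
    refine (convex_convexHull ℝ _).sum_mem (fun _ _ => by positivity) ?_ fun m _ =>
      subset_convexHull ℝ _ ⟨_, fun i => hp i m, rfl⟩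
    simp [hM0]
  · intro R hR ε hε
    obtain ⟨ι, _, w, z, hw, hw1, hz, rfl⟩ := mem_convexHull_iff_exists_fintype.1 hR
    choose q hq hzq using hz
    have hz0 : ∀ k i, 0 ≤ z k i := fun k i => by
      rw [hzq]
      exact singleRate_nonneg hg hN0 hf_nonneg (fun j => binary_nonneg _ (hq k j)) i
    obtain ⟨n, hn⟩ := exists_nat_ge ((∑ i, ∑ k, z k i) / ε)
    refine ⟨n + 1, by omega, fun M hM => ?_⟩
    have hMpos : (0 : ℝ) < M := by exact_mod_cast (by omega : 0 < M)
    have hnM : (n : ℝ) ≤ M := by exact_mod_cast (by omega : n ≤ M)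
    obtain ⟨s, hs, hsum⟩ := exists_sequence_sum_floor_mul_le w hw hw1 q (fun _ => 0) M
    have hsb : ∀ i m, s m i ∈ ({0, Pmax} : Set ℝ) := fun i m => by
      rcases hs m with h | ⟨k, h⟩
      · simp [h]
      · rw [h]
        exact hq k i
    refine ⟨fun i m => s m i, hsb, fun i => ?_⟩
    have hfloor := hsum (fun r => singleRate f g N0 r i) fun m =>
      singleRate_nonneg hg hN0 hf_nonneg (fun j => binary_nonneg _ (hsb j m)) i
    simp only [← hzq] at hfloor
    have hround : ∑ k, (w k * M - 1) * z k i ≤ ∑ k, (⌊w k * M⌋₊ : ℝ) * z k i :=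
      Finset.sum_le_sum fun k _ =>
        mul_le_mul_of_nonneg_right (Nat.sub_one_lt_floor _).le (hz0 k i)
    have hsplit : ∑ k, (w k * M - 1) * z k i = (∑ k, w k * z k i) * M - ∑ k, z k i := by
      rw [Finset.sum_mul, ← Finset.sum_sub_distrib]
      exact Finset.sum_congr rfl fun k _ => by ring
    have herr : ∑ k, z k i ≤ ε * M := by
      calc ∑ k, z k i ≤ ∑ i, ∑ k, z k i :=
            Finset.single_le_sum (f := fun i => ∑ k, z k i)
              (fun i _ => Finset.sum_nonneg fun k _ => hz0 k i) (Finset.mem_univ i)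
        _ ≤ ε * M := by
            rw [mul_comm]
            exact (div_le_iff₀ hε).1 (hn.trans hnM)
    rw [frameRate_eq_mul_sum_singleRate, one_div_mul_eq_div, le_div_iff₀ hMpos]
    simp only [Finset.sum_apply, Pi.smul_apply, smul_eq_mul]
    linarith
end

section
/- (Averaging approximation of convex hulls, underlying Lemma 1.) Let S ⊆ ℝ^N, let x ∈ conv(S), and let ε > 0. Then there exist an integer M ≥ 1 and points s_1, …, s_M ∈ S (repetitions allowed) such that max_{1 ≤ i ≤ N} | (1/M) Σ_{m=1}^M (s_m)_i − x_i | < ε; that is, every point of the convex hull of S is approximated arbitrarily well in sup norm by uniform averages of finitely many points of S. -/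
open Finset

open Filter Topology in
/-- Nonnegative weights of total mass one are limits of the proportions of the natural numbers
`⌊w i * k⌋₊`, so a weighted sum is the limit of the corresponding weighted means. -/
lemma tendsto_sum_floor_mul_div_sum_floor {ι : Type*} [Fintype ι] {w : ι → ℝ}
    (hw : ∀ i, 0 ≤ w i) (hw_sum : ∑ i, w i = 1) (a : ι → ℝ) :
    Tendsto (fun k : ℕ ↦ (∑ i, (⌊w i * k⌋₊ : ℝ) * a i) / ∑ i, (⌊w i * k⌋₊ : ℝ)) atTop
      (𝓝 (∑ i, w i * a i)) := by
  have hfloor (i : ι) : Tendsto (fun k : ℕ ↦ (⌊w i * k⌋₊ : ℝ) / k) atTop (𝓝 (w i)) :=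
    (tendsto_nat_floor_mul_div_atTop (hw i)).comp tendsto_natCast_atTop_atTop
  have hnum := tendsto_finsetSum univ fun i _ ↦ (hfloor i).mul_const (a i)
  have hden := tendsto_finsetSum univ fun i _ ↦ hfloor i
  rw [hw_sum] at hden
  have hquot := hnum.div hden one_ne_zero
  rw [div_one] at hquot
  refine hquot.congr' ?_
  filter_upwards [eventually_ne_atTop 0] with k hk
  have hk' : (k : ℝ) ≠ 0 := Nat.cast_ne_zero.mpr hk
  simp only [Pi.div_apply, div_mul_eq_mul_div, ← Finset.sum_div]
  exact div_div_div_cancel_right₀ hk' _ _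

open Filter Topology in
/-- Weights of total mass one have some `⌊w i * k⌋₊` positive for all large `k`. -/
lemma eventually_one_le_sum_floor_mul {ι : Type*} [Fintype ι] {w : ι → ℝ}
    (hw_sum : ∑ i, w i = 1) :
    ∀ᶠ k : ℕ in atTop, 1 ≤ ∑ i, ⌊w i * k⌋₊ := by
  obtain ⟨i, hi⟩ : ∃ i, 0 < w i := by
    by_contra! h
    have := Finset.sum_nonpos fun i (_ : i ∈ univ) ↦ h i
    linarith
  have htop : Tendsto (fun k : ℕ ↦ w i * (k : ℝ)) atTop atTop :=
    tendsto_natCast_atTop_atTop.const_mul_atTop hi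
  filter_upwards [htop.eventually_ge_atTop 1] with k hk
  exact ((Nat.one_le_floor_iff _).mpr hk).trans
    (Finset.single_le_sum (f := fun i ↦ ⌊w i * k⌋₊) (fun _ _ ↦ Nat.zero_le _) (mem_univ i))

/-- Averaging approximation of convex hulls: every point of `conv(S)` is
approximated arbitrarily well in sup norm by uniform averages of finitely many
points of `S` (repetitions allowed). -/
theorem convexHull_approx_by_uniform_averages
    {N : ℕ} (S : Set (Fin N → ℝ)) (x : Fin N → ℝ)
    (hx : x ∈ convexHull ℝ S) (ε : ℝ) (hε : 0 < ε) :
    ∃ (M : ℕ), 1 ≤ M ∧ ∃ s : Fin M → (Fin N → ℝ),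
      (∀ m, s m ∈ S) ∧
      ∀ i, |(1 / (M : ℝ)) * ∑ m, s m i - x i| < ε := by
  obtain ⟨ι, _, w, z, hw, hw_sum, hz, rfl⟩ := mem_convexHull_iff_exists_fintype.mp hx
  have hclose : ∀ᶠ k : ℕ in Filter.atTop, ∀ j : Fin N,
      |(∑ i, (⌊w i * k⌋₊ : ℝ) * z i j) / ∑ i, (⌊w i * k⌋₊ : ℝ) - ∑ i, w i * z i j| < ε := by
    refine Filter.eventually_all.mpr fun j ↦ ?_
    exact Metric.tendsto_nhds.mp
      (tendsto_sum_floor_mul_div_sum_floor hw hw_sum fun i ↦ z i j) ε hε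
  obtain ⟨k, hk, hk_pos⟩ := (hclose.and (eventually_one_le_sum_floor_mul hw_sum)).exists
  let e : Fin (∑ i, ⌊w i * k⌋₊) ≃ Σ i, Fin ⌊w i * k⌋₊ :=
    (Fintype.equivFinOfCardEq (by simp)).symm
  refine ⟨_, hk_pos, fun m ↦ z (e m).1, fun m ↦ hz _, fun j ↦ ?_⟩
  rw [Equiv.sum_comp e fun p ↦ z p.1 j, Fintype.sum_sigma]
  simpa [one_div, div_eq_inv_mul] using hk j
end

section
/- (Repulsive rearrangement dominates, used to show R_M^IBPP = \bar S_M for two links.) Let N = 2 links and M ≥ 1 slots. Let p be a binary multi-slot allocation in which link 1 transmits at power P_max exactly in a set S_1 of k_1 slots and link 2 transmits at power P_max exactly in a set S_2 of k_2 slots. Let p' be the binary allocation in which link 1 transmits at P_max exactly in slots 1,…,k_1 and link 2 transmits at P_max exactly in slots M−k_2+1,…,M. Then R_1(p') ≥ R_1(p) and R_2(p') ≥ R_2(p). -/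
open Finset

/-- Two sets that are disjoint or cover the whole type minimise the size of the intersection
among all pairs of sets of the same sizes. -/
lemma card_inter_le_card_inter_of_disjoint_or_union_eq_univ {α : Type*} [Fintype α]
    [DecidableEq α] {A B A' B' : Finset α} (hA : A'.card = A.card) (hB : B'.card = B.card)
    (h : Disjoint A' B' ∨ A' ∪ B' = univ) : (A' ∩ B').card ≤ (A ∩ B).card := by
  rcases h with h | h
  · simp [disjoint_iff_inter_eq_empty.mp h]
  · have h₁ := card_union_add_card_inter A B
    have h₂ := card_union_add_card_inter A' B'
    have h₃ : (A ∪ B).card ≤ (A' ∪ B').card := card_le_card (h ▸ subset_univ _)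
    omega

/-- The sum of the rates of an on/off signal active on `A` under an on/off interferer active
on `B`, in terms of cardinalities. -/
lemma sum_rate_eq_card {α : Type*} [Fintype α] [DecidableEq α] {f : ℝ → ℝ} (hf0 : f 0 = 0)
    (c d n P : ℝ) (A B : Finset α) :
    ∑ m, f (c * (if m ∈ A then P else 0) / (n + d * (if m ∈ B then P else 0))) =
      A.card * f (c * P / n) - (A ∩ B).card * (f (c * P / n) - f (c * P / (n + d * P))) := by
  have key : ∀ m, f (c * (if m ∈ A then P else 0) / (n + d * (if m ∈ B then P else 0))) =
      (if m ∈ A then f (c * P / n) else 0) -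
        (if m ∈ A ∩ B then f (c * P / n) - f (c * P / (n + d * P)) else 0) := by
    intro m
    by_cases hA : m ∈ A <;> by_cases hB : m ∈ B <;> simp [hA, hB, hf0]
  simp only [key, sum_sub_distrib, sum_ite_mem, univ_inter, sum_const, nsmul_eq_mul]
  ring

/-- Shrinking the overlap with the interferer, at equal activity, does not decrease the sum rate. -/
lemma sum_rate_le_of_card_inter_le {α : Type*} [Fintype α] [DecidableEq α] {f : ℝ → ℝ}
    (hf_mono : MonotoneOn f (Set.Ici 0)) (hf0 : f 0 = 0) {c d n P : ℝ} (hc : 0 ≤ c) (hd : 0 ≤ d)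
    (hn : 0 < n) (hP : 0 ≤ P) {A B A' B' : Finset α} (hA : A'.card = A.card)
    (h : (A' ∩ B').card ≤ (A ∩ B).card) :
    ∑ m, f (c * (if m ∈ A then P else 0) / (n + d * (if m ∈ B then P else 0))) ≤
      ∑ m, f (c * (if m ∈ A' then P else 0) / (n + d * (if m ∈ B' then P else 0))) := by
  have hdP : 0 ≤ d * P := mul_nonneg hd hP
  have hle : f (c * P / (n + d * P)) ≤ f (c * P / n) := by
    apply hf_mono
    · exact Set.mem_Ici.mpr (by positivity)
    · exact Set.mem_Ici.mpr (by positivity)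
    · exact div_le_div_of_nonneg_left (by positivity) hn (by linarith)
  rw [sum_rate_eq_card hf0, sum_rate_eq_card hf0, hA]
  have h' : ((A' ∩ B').card : ℝ) ≤ (A ∩ B).card := by exact_mod_cast h
  have := mul_le_mul_of_nonneg_right h' (sub_nonneg.mpr hle)
  linarith

/-- Repulsive rearrangement dominates (two links): if link 1 transmits at full
power in a set `S1` of `k1` slots and link 2 in a set `S2` of `k2` slots, then
moving link 1 to the first `k1` slots and link 2 to the last `k2` slots does not
decrease either link's frame rate. -/
theorem repulsive_rearrangement_dominates
    (M : ℕ) (hM : 1 ≤ M) (f : ℝ → ℝ) (g : Fin 2 → Fin 2 → ℝ) (N0 Pmax : ℝ)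
    (hg : ∀ i j, 0 < g i j) (hN0 : 0 < N0) (hP : 0 < Pmax)
    (hf_cont : ContinuousOn f (Set.Ici 0)) (hf_mono : MonotoneOn f (Set.Ici 0))
    (hf_conc : ConcaveOn ℝ (Set.Ici 0) f) (hf0 : f 0 = 0)
    (hf_nonneg : ∀ x ∈ Set.Ici (0 : ℝ), 0 ≤ f x)
    (S1 S2 : Finset (Fin M)) (k1 k2 : ℕ) (hk1 : S1.card = k1) (hk2 : S2.card = k2)
    (p p' : Fin 2 → Fin M → ℝ)
    (hp1 : ∀ m, p 0 m = if m ∈ S1 then Pmax else 0)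
    (hp2 : ∀ m, p 1 m = if m ∈ S2 then Pmax else 0)
    (hp'1 : ∀ m : Fin M, p' 0 m = if m.val < k1 then Pmax else 0)
    (hp'2 : ∀ m : Fin M, p' 1 m = if M - k2 ≤ m.val then Pmax else 0) :
    frameRate f g N0 p 0 ≤ frameRate f g N0 p' 0 ∧
    frameRate f g N0 p 1 ≤ frameRate f g N0 p' 1 := by
  have hk1M : k1 ≤ M := hk1 ▸ card_finset_fin_le S1
  have hk2M : k2 ≤ M := hk2 ▸ card_finset_fin_le S2
  let T1 : Finset (Fin M) := {m | m.val < k1}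
  let T2 : Finset (Fin M) := {m | M - k2 ≤ m.val}
  have hT1 : T1.card = S1.card := by
    rw [hk1, Fin.card_filter_val_lt, min_eq_right hk1M]
  have hT2 : T2.card = S2.card := by
    have h := card_filter_add_card_filter_not (s := (univ : Finset (Fin M)))
      (fun m => m.val < M - k2)
    simp only [not_lt, Fin.card_filter_val_lt, card_univ, Fintype.card_fin] at h
    change _ + T2.card = M at h
    omega
  have hT : Disjoint T1 T2 ∨ T1 ∪ T2 = univ := by
    rcases le_total k1 (M - k2) with h | h
    · left
      rw [disjoint_left]
      intro m h₁ h₂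
      simp only [T1, T2, mem_filter, mem_univ, true_and] at h₁ h₂
      omega
    · right
      ext m
      simp only [T1, T2, mem_union, mem_filter, mem_univ, true_and, iff_true]
      omega
  have hinter := card_inter_le_card_inter_of_disjoint_or_union_eq_univ hT1 hT2 hT
  replace hp'1 : ∀ m, p' 0 m = if m ∈ T1 then Pmax else 0 := by simpa [T1] using hp'1
  replace hp'2 : ∀ m, p' 1 m = if m ∈ T2 then Pmax else 0 := by simpa [T2] using hp'2
  have h0 : (univ \ {0} : Finset (Fin 2)) = {1} := by decide
  have h1 : (univ \ {1} : Finset (Fin 2)) = {0} := by decide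
  constructor
  · simp only [frameRate, h0, sum_singleton, hp1, hp2, hp'1, hp'2]
    exact mul_le_mul_of_nonneg_left
      (sum_rate_le_of_card_inter_le hf_mono hf0 (hg 0 0).le (hg 1 0).le hN0 hP.le hT1 hinter)
      (by positivity)
  · simp only [frameRate, h1, sum_singleton, hp1, hp2, hp'1, hp'2]
    refine mul_le_mul_of_nonneg_left
      (sum_rate_le_of_card_inter_le hf_mono hf0 (hg 1 1).le (hg 0 1).le hN0 hP.le hT2 ?_)
      (by positivity)
    rwa [inter_comm T2, inter_comm S2]
end

section
/- (Lemma 2, first part: lim_{M→∞} R_M^IPP = conv(S_1) for two links.) Let N = 2. For every R ∈ conv(S_1) and every ε > 0, there exist a frame size M ≥ 1 and a repulsive multi-slot power allocation p ∈ [0,P_max]^{2M} such that R_i(p) ≥ R_i − ε for i = 1, 2. -/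
open Finset

/-- A two-link `M`-slot allocation `p` is repulsive if, after a permutation `σ`
of the slots (slots indexed `1,…,M` via `m.val + 1`), link 1 transmits at full
power in a prefix (up to slot `m₁`, with slot `m₁+1` arbitrary and zero after)
and link 2 transmits at full power in a suffix (from slot `m₂`, with slot
`m₂−1` arbitrary and zero before). -/
def Repulsive {M : ℕ} (Pmax : ℝ) (p : Fin 2 → Fin M → ℝ) : Prop :=
  ∃ σ : Equiv.Perm (Fin M), ∃ m₁ m₂ : ℕ, m₁ ≤ M + 1 ∧ m₂ ≤ M + 1 ∧
    ∀ m : Fin M,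
      (m.val + 1 ≤ m₁ → p 0 (σ m) = Pmax) ∧
      (m₁ + 1 < m.val + 1 → p 0 (σ m) = 0) ∧
      (m₂ ≤ m.val + 1 → p 1 (σ m) = Pmax) ∧
      (m.val + 1 < m₂ - 1 → p 1 (σ m) = 0)

theorem sum_three_blocks (x y z : ℕ) (u v w : ℝ) :
    ∑ m : Fin (x + y + z), (if m.val < x then u else if m.val < x + y then v else w) =
      x * u + y * v + z * w := by
  rw [Fin.sum_univ_eq_sum_range (fun m => if m < x then u else if m < x + y then v else w),
    Finset.sum_range_add, Finset.sum_range_add]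
  have h₁ : ∑ m ∈ range x, (if m < x then u else if m < x + y then v else w) = x * u := by
    rw [Finset.sum_congr rfl fun m hm => if_pos (Finset.mem_range.mp hm)]
    simp
  have h₂ : ∑ m ∈ range y, (if x + m < x then u else if x + m < x + y then v else w) = y * v := by
    rw [Finset.sum_congr rfl (g := fun _ => v) fun m hm => by simp_all]
    simp
  have h₃ : ∑ m ∈ range z,
      (if x + y + m < x then u else if x + y + m < x + y then v else w) = z * w := by
    rw [Finset.sum_congr rfl (g := fun _ => w) fun m hm => by
      rw [if_neg (by omega), if_neg (by omega)]]
    simp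
  rw [h₁, h₂, h₃]

/-- Points of the convex hull of `0`, `(a, 0)`, `(0, b)`, `(c, d)` in terms of weights. -/
theorem exists_weights_of_mem_convexHull {S : Set (Fin 2 → ℝ)} {a b c d : ℝ}
    (hS : ∀ r ∈ S, (r 0 = 0 ∧ r 1 = 0) ∨ (r 0 = a ∧ r 1 = 0) ∨ (r 0 = 0 ∧ r 1 = b) ∨
      (r 0 = c ∧ r 1 = d)) {R : Fin 2 → ℝ} (hR : R ∈ convexHull ℝ S) :
    ∃ α β γ : ℝ, 0 ≤ α ∧ 0 ≤ β ∧ 0 ≤ γ ∧ α + β + γ ≤ 1 ∧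
      R 0 = α * a + γ * c ∧ R 1 = β * b + γ * d := by
  let T : Set (Fin 2 → ℝ) := {R | ∃ α β γ : ℝ, 0 ≤ α ∧ 0 ≤ β ∧ 0 ≤ γ ∧ α + β + γ ≤ 1 ∧
      R 0 = α * a + γ * c ∧ R 1 = β * b + γ * d}
  have hT : Convex ℝ T := by
    rintro R ⟨α, β, γ, hα, hβ, hγ, hs, h₀, h₁⟩ R' ⟨α', β', γ', hα', hβ', hγ', hs', h₀', h₁'⟩
      s t hs0 ht0 hst
    refine ⟨s * α + t * α', s * β + t * β', s * γ + t * γ', by positivity, by positivity,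
      by positivity, ?_, ?_, ?_⟩
    · nlinarith [mul_le_mul_of_nonneg_left hs hs0, mul_le_mul_of_nonneg_left hs' ht0]
    · simp only [Pi.add_apply, Pi.smul_apply, smul_eq_mul, h₀, h₀']
      ring
    · simp only [Pi.add_apply, Pi.smul_apply, smul_eq_mul, h₁, h₁']
      ring
  refine convexHull_min (t := T) (fun r hr => ?_) hT hR
  rcases hS r hr with ⟨h₀, h₁⟩ | ⟨h₀, h₁⟩ | ⟨h₀, h₁⟩ | ⟨h₀, h₁⟩
  · exact ⟨0, 0, 0, by simp [h₀, h₁]⟩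
  · exact ⟨1, 0, 0, by simp [h₀, h₁]⟩
  · exact ⟨0, 1, 0, by simp [h₀, h₁]⟩
  · exact ⟨0, 0, 1, by simp [h₀, h₁]⟩

/-- Link 1 transmits in the first `x + y` slots, link 2 in the last `y + z` slots. -/
def blockAllocation (Pmax : ℝ) (x y z : ℕ) (i : Fin 2) (m : Fin (x + y + z)) : ℝ :=
  if i = 0 then (if m.val < x + y then Pmax else 0) else (if m.val < x then 0 else Pmax)

theorem repulsive_blockAllocation (Pmax : ℝ) (x y z : ℕ) :
    Repulsive Pmax (blockAllocation Pmax x y z) := by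
  refine ⟨Equiv.refl _, x + y, x + 1, by omega, by omega, fun m =>
    ⟨fun h => ?_, fun h => ?_, fun h => ?_, fun h => ?_⟩⟩
  · exact (if_pos rfl).trans (if_pos (by simpa using h))
  · exact (if_pos rfl).trans (if_neg (by simp; omega))
  · exact (if_neg one_ne_zero).trans (if_neg (by simp; omega))
  · exact (if_neg one_ne_zero).trans (if_pos (by simp; omega))

theorem compl_singleton_fin_two (i : Fin 2) : (univ \ {i} : Finset (Fin 2)) = {1 - i} := by
  revert i
  decide

theorem frameRate_blockAllocation_zero {f : ℝ → ℝ} (hf0 : f 0 = 0) (g : Fin 2 → Fin 2 → ℝ)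
    (N0 Pmax : ℝ) (x y z : ℕ) :
    frameRate f g N0 (blockAllocation Pmax x y z) 0 =
      (x * f (g 0 0 * Pmax / N0) + y * f (g 0 0 * Pmax / (N0 + g 1 0 * Pmax))) /
        ((x + y + z : ℕ) : ℝ) := by
  have h := sum_three_blocks x y z (f (g 0 0 * Pmax / N0))
    (f (g 0 0 * Pmax / (N0 + g 1 0 * Pmax))) 0
  rw [mul_zero, add_zero] at h
  rw [frameRate, one_div_mul_eq_div, ← h]
  congr 1
  refine Finset.sum_congr rfl fun m _ => ?_
  rw [compl_singleton_fin_two, Finset.sum_singleton]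
  by_cases h₁ : m.val < x
  · simp [blockAllocation, h₁, Nat.lt_add_right y h₁]
  · by_cases h₂ : m.val < x + y <;> simp [blockAllocation, h₁, h₂, hf0]

theorem frameRate_blockAllocation_one {f : ℝ → ℝ} (hf0 : f 0 = 0) (g : Fin 2 → Fin 2 → ℝ)
    (N0 Pmax : ℝ) (x y z : ℕ) :
    frameRate f g N0 (blockAllocation Pmax x y z) 1 =
      (y * f (g 1 1 * Pmax / (N0 + g 0 1 * Pmax)) + z * f (g 1 1 * Pmax / N0)) /
        ((x + y + z : ℕ) : ℝ) := by
  have h := sum_three_blocks x y z 0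
    (f (g 1 1 * Pmax / (N0 + g 0 1 * Pmax))) (f (g 1 1 * Pmax / N0))
  rw [mul_zero, zero_add] at h
  rw [frameRate, one_div_mul_eq_div, ← h]
  congr 1
  refine Finset.sum_congr rfl fun m _ => ?_
  rw [compl_singleton_fin_two, Finset.sum_singleton]
  by_cases h₁ : m.val < x
  · simp [blockAllocation, h₁, hf0]
  · by_cases h₂ : m.val < x + y <;> simp [blockAllocation, h₁, h₂]

/-- Lemma 2, first part: `lim_{M→∞} R_M^IPP = conv(S_1)` for two links: every
point of `conv(S_1)` is approached coordinatewise from below, within any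
`ε > 0`, by the rate vector of a repulsive multi-slot allocation. -/
theorem repulsive_allocations_approach_schedule_region
    (f : ℝ → ℝ) (g : Fin 2 → Fin 2 → ℝ) (N0 Pmax : ℝ)
    (hg : ∀ i j, 0 < g i j) (hN0 : 0 < N0) (hP : 0 < Pmax)
    (hf_cont : ContinuousOn f (Set.Ici 0)) (hf_mono : MonotoneOn f (Set.Ici 0))
    (hf_conc : ConcaveOn ℝ (Set.Ici 0) f) (hf0 : f 0 = 0)
    (hf_nonneg : ∀ x ∈ Set.Ici (0 : ℝ), 0 ≤ f x)
    (R : Fin 2 → ℝ)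
    (hR : R ∈ convexHull ℝ {r : Fin 2 → ℝ | ∃ q : Fin 2 → ℝ,
      (∀ i, q i ∈ ({0, Pmax} : Set ℝ)) ∧ r = singleRate f g N0 q})
    (ε : ℝ) (hε : 0 < ε) :
    ∃ M : ℕ, 1 ≤ M ∧ ∃ p : Fin 2 → Fin M → ℝ,
      (∀ i m, p i m ∈ Set.Icc 0 Pmax) ∧
      Repulsive Pmax p ∧
      ∀ i, R i - ε ≤ frameRate f g N0 p i := by
  set a := f (g 0 0 * Pmax / N0) with ha_def
  set b := f (g 1 1 * Pmax / N0) with hb_def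
  set c := f (g 0 0 * Pmax / (N0 + g 1 0 * Pmax)) with hc_def
  set d := f (g 1 1 * Pmax / (N0 + g 0 1 * Pmax)) with hd_def
  have h00 := hg 0 0
  have h01 := hg 0 1
  have h10 := hg 1 0
  have h11 := hg 1 1
  have ha : 0 ≤ a := hf_nonneg _ (Set.mem_Ici.mpr (by positivity))
  have hb : 0 ≤ b := hf_nonneg _ (Set.mem_Ici.mpr (by positivity))
  have hc : 0 ≤ c := hf_nonneg _ (Set.mem_Ici.mpr (by positivity))
  have hd : 0 ≤ d := hf_nonneg _ (Set.mem_Ici.mpr (by positivity))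
  obtain ⟨α, β, γ, hα, hβ, hγ, hs, hR₀, hR₁⟩ :=
    exists_weights_of_mem_convexHull (a := a) (b := b) (c := c) (d := d) (by
      rintro r ⟨q, hq, rfl⟩
      simp only [singleRate, compl_singleton_fin_two, Finset.sum_singleton, sub_zero, sub_self]
      rcases hq 0 with h₀ | h₀ <;> rcases hq 1 with h₁ | h₁ <;>
        simp_all) hR
  obtain ⟨K, hK⟩ := exists_nat_ge ((a + c + d) / ε)
  set M := K + 1 with hM_def
  have hM : (0 : ℝ) < M := by positivity
  have hKM : a + c + d ≤ ε * M := by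
    rw [div_le_iff₀ hε] at hK
    rw [hM_def]
    push_cast
    nlinarith
  set x := ⌊α * M⌋₊
  set y := ⌊γ * M⌋₊
  have hx : (x : ℝ) ≤ α * M := Nat.floor_le (by positivity)
  have hy : (y : ℝ) ≤ γ * M := Nat.floor_le (by positivity)
  have hx' : α * M < x + 1 := Nat.lt_floor_add_one _
  have hy' : γ * M < y + 1 := Nat.lt_floor_add_one _
  have hsM : (α + β + γ) * M ≤ M := mul_le_of_le_one_left hM.le hs
  have hxy : x + y ≤ M := by
    have : (x : ℝ) + y ≤ M := by nlinarith [mul_nonneg hβ hM.le]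
    exact_mod_cast this
  obtain ⟨z, hz⟩ := Nat.exists_eq_add_of_le hxy
  have hzM : (M : ℝ) = x + y + z := by exact_mod_cast hz
  have hβz : β * M ≤ z := by linarith
  refine ⟨x + y + z, by omega, blockAllocation Pmax x y z, fun i m => ?_,
    repulsive_blockAllocation Pmax x y z, fun i => ?_⟩
  · unfold blockAllocation
    split_ifs <;> simp [hP.le]
  · fin_cases i
    · simp only [Fin.zero_eta, frameRate_blockAllocation_zero hf0, ← hz]
      rw [hR₀, ← ha_def, ← hc_def, le_div_iff₀ hM]
      nlinarith [mul_le_mul_of_nonneg_right hx'.le ha, mul_le_mul_of_nonneg_right hy'.le hc]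
    · simp only [Fin.mk_one, frameRate_blockAllocation_one hf0, ← hz]
      rw [hR₁, ← hb_def, ← hd_def, le_div_iff₀ hM]
      nlinarith [mul_le_mul_of_nonneg_right hβz hb, mul_le_mul_of_nonneg_right hy'.le hd]
end

section
/- (R_M^IBPP = \bar S_M for two links.) Let N = 2 and M ≥ 1. Then { R ∈ ℝ_+^2 : there exists a repulsive binary multi-slot allocation p ∈ {0,P_max}^{2M} with R_i ≤ R_i(p) for i = 1,2 } = \bar S_M, where \bar S_M = { R ∈ ℝ_+^2 : there exists a binary multi-slot allocation p with R_i ≤ R_i(p) for i = 1,2 } is the coordinate-convex hull of the set of M-slot schedules. -/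
open Finset

/-- The binary allocation in which link `i` transmits at full power exactly in the slots `S i`. -/
noncomputable def schedule {M : ℕ} (Pmax : ℝ) (S : Fin 2 → Finset (Fin M)) :
    Fin 2 → Fin M → ℝ :=
  fun i m => if m ∈ S i then Pmax else 0

/-- The frame rate of a schedule depends only on how many slots a link uses and on how many slots
the two links share. -/
theorem frameRate_schedule {M : ℕ} {f : ℝ → ℝ} (hf0 : f 0 = 0) (g : Fin 2 → Fin 2 → ℝ)
    (N0 Pmax : ℝ) (S : Fin 2 → Finset (Fin M)) (i : Fin 2) :
    frameRate f g N0 (schedule Pmax S) i =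
      (1 / (M : ℝ)) * ((#(S i) : ℝ) * f (g i i * Pmax / N0) -
        (#(S 0 ∩ S 1) : ℝ) *
          (f (g i i * Pmax / N0) - f (g i i * Pmax / (N0 + g (1 - i) i * Pmax)))) := by
  have hsum (m : Fin M) : ∑ j ∈ univ \ {i}, g j i * schedule Pmax S j m =
      g (1 - i) i * schedule Pmax S (1 - i) m := by
    have h : univ \ {i} = ({1 - i} : Finset (Fin 2)) := by
      revert i
      decide
    rw [h, sum_singleton]
  have hinter (m : Fin M) : m ∈ S 0 ∩ S 1 ↔ m ∈ S i ∧ m ∈ S (1 - i) := by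
    fin_cases i <;> simp [and_comm]
  have hcard (T : Finset (Fin M)) : (#T : ℝ) = ∑ m, if m ∈ T then 1 else 0 := by simp
  unfold frameRate
  rw [hcard (S i), hcard (S 0 ∩ S 1), sum_mul, sum_mul, ← sum_sub_distrib]
  congr 1
  refine sum_congr rfl fun m _ => ?_
  rw [hsum]
  by_cases h₁ : m ∈ S i <;> by_cases h₂ : m ∈ S (1 - i) <;>
    simp only [schedule, hinter, h₁, h₂, and_true, and_false, and_self, if_true, if_false,
      mul_zero, zero_mul, add_zero, zero_div, hf0] <;> ring

theorem eq_schedule_of_binary {M : ℕ} {Pmax : ℝ} {p : Fin 2 → Fin M → ℝ}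
    (hp : ∀ i m, p i m ∈ ({0, Pmax} : Set ℝ)) :
    p = schedule Pmax fun i => {m | p i m = Pmax} := by
  funext i m
  rcases hp i m with h | h
  · by_cases h' : p i m = Pmax
    · simp [schedule, h']
    · simpa [schedule, h'] using h
  · have h' : p i m = Pmax := h
    simp [schedule, h']

theorem schedule_mem {M : ℕ} (Pmax : ℝ) (S : Fin 2 → Finset (Fin M)) (i : Fin 2) (m : Fin M) :
    schedule Pmax S i m ∈ ({0, Pmax} : Set ℝ) := by
  by_cases h : m ∈ S i <;> simp [schedule, h]

/-- Sharing fewer slots, with the same number of slots per link, improves both rates. -/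
theorem frameRate_schedule_le {M : ℕ} {f : ℝ → ℝ} {g : Fin 2 → Fin 2 → ℝ} {N0 Pmax : ℝ}
    (hg : ∀ i j, 0 < g i j) (hN0 : 0 < N0) (hP : 0 < Pmax)
    (hf_mono : MonotoneOn f (Set.Ici 0)) (hf0 : f 0 = 0)
    {S T : Fin 2 → Finset (Fin M)} (hcard : ∀ i, #(S i) = #(T i))
    (hinter : #(T 0 ∩ T 1) ≤ #(S 0 ∩ S 1)) (i : Fin 2) :
    frameRate f g N0 (schedule Pmax S) i ≤ frameRate f g N0 (schedule Pmax T) i := by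
  have hsig : 0 < g i i * Pmax := mul_pos (hg i i) hP
  have hint : 0 < g (1 - i) i * Pmax := mul_pos (hg _ i) hP
  have hloss : f (g i i * Pmax / (N0 + g (1 - i) i * Pmax)) ≤ f (g i i * Pmax / N0) := by
    refine hf_mono (Set.mem_Ici.2 (by positivity)) (Set.mem_Ici.2 (by positivity)) ?_
    gcongr
    linarith
  rw [frameRate_schedule hf0, frameRate_schedule hf0, hcard i]
  have := sub_nonneg.2 hloss
  gcongr

theorem card_filter_fin_Ico {M l u : ℕ} (hu : u ≤ M) :
    #{m : Fin M | l ≤ m.val ∧ m.val < u} = u - l := by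
  rw [← Nat.card_Ico, ← card_map Fin.valEmbedding]
  congr 1
  ext k
  simp only [mem_map, mem_filter, mem_univ, true_and, Fin.valEmbedding_apply, mem_Ico]
  exact ⟨fun ⟨m, h, hm⟩ => hm ▸ h, fun h => ⟨⟨k, h.2.trans_le hu⟩, h, rfl⟩⟩

/-- The slots of the schedule in which link 1 uses the first `a` slots and link 2 the last `b`. -/
def prefixSuffix (M a b : ℕ) : Fin 2 → Finset (Fin M) :=
  ![({m | m.val < a} : Finset (Fin M)), ({m | M - b ≤ m.val} : Finset (Fin M))]

theorem card_prefixSuffix_zero {M a : ℕ} (b : ℕ) (ha : a ≤ M) :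
    #(prefixSuffix M a b 0) = a := by
  simpa [prefixSuffix] using card_filter_fin_Ico (l := 0) ha

theorem card_prefixSuffix_one {M b : ℕ} (a : ℕ) (hb : b ≤ M) :
    #(prefixSuffix M a b 1) = b := by
  have h := card_filter_fin_Ico (l := M - b) (le_refl M)
  simp only [Fin.is_lt, and_true] at h
  simp only [prefixSuffix, Matrix.cons_val_one, Matrix.cons_val_fin_one, h]
  omega

theorem card_prefixSuffix_inter {M a : ℕ} (b : ℕ) (ha : a ≤ M) :
    #(prefixSuffix M a b 0 ∩ prefixSuffix M a b 1) = a - (M - b) := by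
  rw [← card_filter_fin_Ico ha]
  congr 1
  ext m
  simp [prefixSuffix, and_comm]

theorem repulsive_prefixSuffix {M a b : ℕ} (Pmax : ℝ) (ha : a ≤ M) :
    Repulsive Pmax (schedule Pmax (prefixSuffix M a b)) := by
  refine ⟨1, a, M - b + 1, by omega, by omega, fun m => ⟨?_, ?_, ?_, ?_⟩⟩ <;> intro h <;>
    simp only [schedule, prefixSuffix, Equiv.Perm.coe_one, id_eq, Matrix.cons_val_zero,
      Matrix.cons_val_one, Matrix.cons_val_fin_one, mem_filter, mem_univ, true_and] <;>
    first
      | exact if_pos (by omega)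
      | exact if_neg (by omega)

/-- `R_M^IBPP = \bar S_M` for two links: the set of nonnegative rate vectors
dominated by the rate vector of some repulsive binary `M`-slot allocation
coincides with the coordinate-convex hull `\bar S_M` of the set of `M`-slot
schedules. -/
theorem repulsive_binary_region_eq_coordinate_convex_schedules
    (M : ℕ) (hM : 1 ≤ M) (f : ℝ → ℝ) (g : Fin 2 → Fin 2 → ℝ) (N0 Pmax : ℝ)
    (hg : ∀ i j, 0 < g i j) (hN0 : 0 < N0) (hP : 0 < Pmax)
    (hf_cont : ContinuousOn f (Set.Ici 0)) (hf_mono : MonotoneOn f (Set.Ici 0))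
    (hf_conc : ConcaveOn ℝ (Set.Ici 0) f) (hf0 : f 0 = 0)
    (hf_nonneg : ∀ x ∈ Set.Ici (0 : ℝ), 0 ≤ f x) :
    {R : Fin 2 → ℝ | (∀ i, 0 ≤ R i) ∧ ∃ p : Fin 2 → Fin M → ℝ,
        (∀ i m, p i m ∈ ({0, Pmax} : Set ℝ)) ∧ Repulsive Pmax p ∧
        ∀ i, R i ≤ frameRate f g N0 p i}
    =
    {R : Fin 2 → ℝ | (∀ i, 0 ≤ R i) ∧ ∃ p : Fin 2 → Fin M → ℝ,
        (∀ i m, p i m ∈ ({0, Pmax} : Set ℝ)) ∧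
        ∀ i, R i ≤ frameRate f g N0 p i} := by
  ext R
  refine ⟨fun ⟨hR, p, hp, _, hle⟩ => ⟨hR, p, hp, hle⟩, fun ⟨hR, p, hp, hle⟩ => ?_⟩
  set S : Fin 2 → Finset (Fin M) := fun i => {m | p i m = Pmax}
  have hpS : p = schedule Pmax S := eq_schedule_of_binary hp
  have hS (i : Fin 2) : #(S i) ≤ M := (card_le_univ _).trans_eq (Fintype.card_fin M)
  have hunion : #(S 0 ∪ S 1) ≤ M := (card_le_univ _).trans_eq (Fintype.card_fin M)
  have hinter := card_union_add_card_inter (S 0) (S 1)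
  refine ⟨hR, schedule Pmax (prefixSuffix M #(S 0) #(S 1)), schedule_mem _ _,
    repulsive_prefixSuffix Pmax (hS 0), fun i => (hle i).trans ?_⟩
  rw [hpS]
  refine frameRate_schedule_le hg hN0 hP hf_mono hf0 ?_ ?_ i
  · rw [Fin.forall_fin_two, card_prefixSuffix_zero _ (hS 0), card_prefixSuffix_one _ (hS 1)]
    exact ⟨rfl, rfl⟩
  · rw [card_prefixSuffix_inter _ (hS 0)]
    have := hS 1
    omega
end

section
/- (Theorem 1, continuous version: convergence of Iterative Power Packing for two links.) Let N = 2 and M ≥ 1. Let s : ℕ → {1,2} be an update sequence in which each of 1 and 2 occurs infinitely often. Starting from an arbitrary allocation p[0] ∈ [0,P_max]^{2M}, define p[t] from p[t−1] by replacing link-s[t]'s allocation with its PP response (with ties in interference broken by slot index) to the interference generated by the other link's allocation in p[t−1], the other link's allocation being unchanged. If the target rate vector R^t = (R^t_1, R^t_2) satisfies R^t ∈ R_M^IPP (i.e., there exists a repulsive allocation q ∈ [0,P_max]^{2M} with R(q) = R^t), then the sequence p[t] converges in [0,P_max]^{2M} to a repulsive allocation p satisfying R_i(p) = R^t_i for i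 = 1, 2. -/
open Finset

/-- `q` is the Power Packing response (ties in interference broken by slot
index) to interference levels `I`, for a transmitter with direct gain `gii`,
power budget `Pmax` and target rate `Rt`: if even full power in every slot does
not reach the target, `q = 0`; otherwise, sort the slots by nondecreasing
interference (ties broken by slot index) via the permutation `σ`, let `m̃` be
the least number of slots whose full-power rates reach the target, transmit at
full power in the first `m̃ − 1` sorted slots, at the unique intermediate power
level in the `m̃`-th sorted slot making the achieved rate exactly `Rt`, and
remain silent in the remaining slots. -/
def IsPPResponse {M : ℕ} (f : ℝ → ℝ) (gii Pmax Rt : ℝ)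
    (I : Fin M → ℝ) (q : Fin M → ℝ) : Prop :=
  ((1 / (M : ℝ)) * ∑ m, f (gii * Pmax / I m) < Rt → q = 0) ∧
  (Rt ≤ (1 / (M : ℝ)) * ∑ m, f (gii * Pmax / I m) →
    ∃ σ : Equiv.Perm (Fin M),
      (∀ l l' : Fin M, l < l' →
        I (σ l) < I (σ l') ∨ (I (σ l) = I (σ l') ∧ σ l < σ l')) ∧
      ∃ mt : ℕ,
        IsLeast {k : ℕ | Rt ≤ (1 / (M : ℝ)) *
          ∑ m ∈ univ.filter (fun m : Fin M => m.val < k),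
            f (gii * Pmax / I (σ m))} mt ∧
        (∀ m : Fin M, m.val + 1 < mt → q (σ m) = Pmax) ∧
        (∀ m : Fin M, mt < m.val + 1 → q (σ m) = 0) ∧
        (∀ m : Fin M, m.val + 1 = mt → q (σ m) ∈ Set.Icc 0 Pmax) ∧
        (1 / (M : ℝ)) * ∑ m, f (gii * q m / I m) = Rt)

/-- The part of the unit interval `[k, k + 1]` lying to the left of `x`. -/
noncomputable def ramp (x : ℝ) (k : ℕ) : ℝ := max 0 (min 1 (x - k))

/-- The allocation filling the slots in order with total power `P * x`. -/
noncomputable def packed (M : ℕ) (P x : ℝ) : Fin M → ℝ := fun k => P * ramp x k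

theorem ramp_nonneg (x : ℝ) (k : ℕ) : 0 ≤ ramp x k := le_max_left _ _

theorem ramp_le_one (x : ℝ) (k : ℕ) : ramp x k ≤ 1 :=
  max_le zero_le_one (min_le_left _ _)

theorem ramp_eq_one {x : ℝ} {k : ℕ} (h : (k : ℝ) + 1 ≤ x) : ramp x k = 1 := by
  rw [ramp, min_eq_left (by linarith), max_eq_right zero_le_one]

theorem ramp_eq_zero {x : ℝ} {k : ℕ} (h : x ≤ k) : ramp x k = 0 :=
  max_eq_left ((min_le_right _ _).trans (by linarith))

theorem ramp_eq_sub {x : ℝ} {k : ℕ} (h : (k : ℝ) ≤ x) (h' : x ≤ k + 1) : ramp x k = x - k := by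
  rw [ramp, min_eq_right (by linarith), max_eq_right (by linarith)]

theorem ramp_le_zero_iff {x : ℝ} {k : ℕ} : ramp x k ≤ 0 ↔ x ≤ k := by
  simp [ramp]

theorem ramp_lt_one_iff {x : ℝ} {k : ℕ} : ramp x k < 1 ↔ x < k + 1 := by
  simp [ramp, sub_lt_iff_lt_add, add_comm]

theorem ramp_mono (k : ℕ) : Monotone (ramp · k) := fun x y h => by
  simp only [ramp]; gcongr

theorem ramp_anti (x : ℝ) : Antitone (ramp x) := fun k l h => by
  simp only [ramp]; gcongr

theorem sum_ramp {x : ℝ} (hx : 0 ≤ x) (M : ℕ) : ∑ k ∈ range M, ramp x k = min x M := by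
  induction M with
  | zero => simp [hx]
  | succ M ih =>
    rw [sum_range_succ, ih]
    push_cast
    rcases le_total x M with h | h
    · rw [ramp_eq_zero h, min_eq_left h, min_eq_left (by linarith), add_zero]
    · rcases le_total x (M + 1) with h' | h'
      · rw [ramp_eq_sub h h', min_eq_right h, min_eq_left h']; ring
      · rw [ramp_eq_one h', min_eq_right h, min_eq_right h']

section Packed

variable {M : ℕ} {P : ℝ}

theorem packed_nonneg (hP : 0 ≤ P) (x : ℝ) (k : Fin M) : 0 ≤ packed M P x k :=
  mul_nonneg hP (ramp_nonneg _ _)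

theorem packed_le (hP : 0 ≤ P) (x : ℝ) (k : Fin M) : packed M P x k ≤ P :=
  mul_le_of_le_one_right hP (ramp_le_one _ _)

theorem packed_mono (hP : 0 ≤ P) : Monotone (packed M P) := fun _ _ h k =>
  mul_le_mul_of_nonneg_left (ramp_mono k h) hP

theorem packed_anti (hP : 0 ≤ P) (x : ℝ) : Antitone (packed M P x) := fun _ _ h =>
  mul_le_mul_of_nonneg_left (ramp_anti x (Fin.le_def.1 h)) hP

theorem packed_zero : packed M P 0 = 0 := by
  ext k; simp [packed, ramp_eq_zero]

theorem packed_full (k : Fin M) : packed M P M k = P := by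
  rw [packed, ramp_eq_one (by exact_mod_cast k.2), mul_one]

theorem sum_packed {x : ℝ} (hx : x ∈ Set.Icc 0 (M : ℝ)) : ∑ k, packed M P x k = P * x := by
  simp only [packed, ← mul_sum]
  rw [Fin.sum_univ_eq_sum_range (ramp x), sum_ramp hx.1, min_eq_left hx.2]

theorem continuous_packed (k : Fin M) : Continuous fun x => packed M P x k := by
  unfold packed ramp; fun_prop

/-- A `[0, P]`-valued allocation that is full before slot `k` and silent after it is packed. -/
theorem exists_eq_packed (hP : 0 < P) {a : Fin M → ℝ} (k : ℕ)
    (hfull : ∀ m : Fin M, m.val < k → a m = P) (hzero : ∀ m : Fin M, k < m.val → a m = 0)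
    (ha : ∀ m, a m ∈ Set.Icc 0 P) :
    ∃ x ∈ Set.Icc 0 (M : ℝ), a = packed M P x := by
  rcases lt_or_ge k M with hk | hk
  · have h0 : 0 ≤ a ⟨k, hk⟩ / P := div_nonneg (ha _).1 hP.le
    have h1 : a ⟨k, hk⟩ / P ≤ 1 := (div_le_one hP).2 (ha _).2
    have hkM : (k : ℝ) + 1 ≤ M := by exact_mod_cast hk
    refine ⟨k + a ⟨k, hk⟩ / P, ⟨by positivity, by linarith⟩, ?_⟩
    ext m
    rcases lt_trichotomy m.val k with h | h | h
    · have : (m.val : ℝ) + 1 ≤ k := by exact_mod_cast h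
      rw [hfull m h, packed, ramp_eq_one (by linarith), mul_one]
    · obtain rfl : m = ⟨k, hk⟩ := Fin.ext h
      rw [packed, ramp_eq_sub (by simpa using h0) (by simpa using h1)]
      simp only [add_sub_cancel_left]
      field_simp
    · have : (k : ℝ) + 1 ≤ m.val := by exact_mod_cast h
      rw [hzero m h, packed, ramp_eq_zero (by linarith), mul_zero]
  · exact ⟨M, ⟨by positivity, le_rfl⟩,
      funext fun m => (hfull m (m.2.trans_le hk)).trans (packed_full m).symm⟩

end Packed

/-- The power level of a slot on the coarse scale silent, partial, full. -/
noncomputable def powerClass (P v : ℝ) : ℕ := if v ≤ 0 then 0 else if v < P then 1 else 2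

theorem powerClass_mono (P : ℝ) : Monotone (powerClass P) := by
  intro v w h
  unfold powerClass
  split_ifs <;> first | omega | linarith

theorem powerClass_packed {M : ℕ} {P : ℝ} (hP : 0 < P) (x : ℝ) (k : Fin M) :
    powerClass P (packed M P x k) =
      if ⌈x⌉ ≤ (k.val : ℤ) then 0 else if ⌊x⌋ < (k.val : ℤ) + 1 then 1 else 2 := by
  have h1 : packed M P x k ≤ 0 ↔ ⌈x⌉ ≤ (k.val : ℤ) := by
    rw [packed, ← not_lt, mul_pos_iff_of_pos_left hP, not_lt, ramp_le_zero_iff, Int.ceil_le]; simp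
  have h2 : packed M P x k < P ↔ ⌊x⌋ < (k.val : ℤ) + 1 := by
    rw [packed, mul_lt_iff_lt_one_right hP, ramp_lt_one_iff, Int.floor_lt]; simp
  simp only [powerClass, h1, h2]

theorem packed_eq_of_powerClass_eq {M : ℕ} {P : ℝ} (hP : 0 < P) {x : ℝ} {k l : Fin M}
    (h : powerClass P (packed M P x k) = powerClass P (packed M P x l)) :
    packed M P x k = packed M P x l := by
  wlog hkl : k ≤ l generalizing k l
  · exact (this h.symm (le_of_not_ge hkl)).symm
  rcases hkl.eq_or_lt with rfl | hlt
  · rfl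
  have hlt' : (k.val : ℝ) + 1 ≤ l.val := by exact_mod_cast hlt
  rcases le_total x (k.val + 1) with hx | hx
  · have hl : packed M P x l = 0 := by rw [packed, ramp_eq_zero (by linarith), mul_zero]
    rw [hl] at h ⊢
    have : powerClass P (packed M P x k) = 0 := by rw [h]; simp [powerClass]
    refine le_antisymm ?_ (packed_nonneg hP.le _ _)
    by_contra hc
    simp only [powerClass, if_neg hc] at this
    split_ifs at this
  · have hk : packed M P x k = P := by rw [packed, ramp_eq_one hx, mul_one]
    rw [hk] at h ⊢
    refine le_antisymm ?_ (packed_le hP.le _ _)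
    by_contra hc
    have h2 : powerClass P P = 2 := by simp [powerClass, hP]
    rw [h2, powerClass, if_pos (not_le.1 hc)] at h
    split_ifs at h
    omega

/-- A bounded integer sequence that is monotone or antitone is eventually constant. -/
theorem eventually_const_of_monotone_or_antitone {v : ℕ → ℤ} {a b : ℤ}
    (hv : ∀ t, v t ∈ Set.Icc a b) (h : Monotone v ∨ Antitone v) :
    ∃ T, ∀ t ≥ T, v t = v T := by
  have key : ∃ L, Filter.Tendsto v Filter.atTop (nhds L) := by
    rcases h with h | h
    · exact ⟨_, tendsto_atTop_ciSup h ⟨b, by rintro _ ⟨t, rfl⟩; exact (hv t).2⟩⟩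
    · exact ⟨_, tendsto_atTop_ciInf h ⟨a, by rintro _ ⟨t, rfl⟩; exact (hv t).1⟩⟩
  obtain ⟨L, hL⟩ := key
  rw [nhds_discrete, Filter.tendsto_pure, Filter.eventually_atTop] at hL
  obtain ⟨T, hT⟩ := hL
  exact ⟨T, fun t ht => (hT t ht).trans (hT T le_rfl).symm⟩

theorem Fin.eq_or_eq_rev (i j : Fin 2) : j = i ∨ j = i.rev := by
  fin_cases i <;> fin_cases j <;> simp

theorem Fin.forall_two_iff (i : Fin 2) {Q : Fin 2 → Prop} : (∀ j, Q j) ↔ Q i ∧ Q i.rev := by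
  refine ⟨fun h => ⟨h _, h _⟩, fun h j => ?_⟩
  rcases Fin.eq_or_eq_rev i j with rfl | rfl
  exacts [h.1, h.2]

section Dynamics

variable {Φ : Fin 2 → ℝ → ℝ → ℝ} {B : ℝ} {R : Fin 2 → ℝ} {s : ℕ → Fin 2} {X : ℕ → Fin 2 → ℝ}

/-- If the target is achieved by some amounts `Y`, then eventually every update achieves it: an
infeasible update silences a link, after which all amounts stay below `Y`. -/
theorem eventually_target_achieved
    (hmono : ∀ i y, StrictMonoOn (Φ i · y) (Set.Icc 0 B))
    (hanti : ∀ i x, Antitone (Φ i x))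
    (hs : ∀ i t, ∃ t', t ≤ t' ∧ s t' = i)
    (hX : ∀ t i, X t i ∈ Set.Icc 0 B)
    (hkeep : ∀ t, X (t + 1) (s t).rev = X t (s t).rev)
    (hupd : ∀ t, Φ (s t) (X (t + 1) (s t)) (X t (s t).rev) = R (s t) ∨
      (Φ (s t) B (X t (s t).rev) < R (s t) ∧ X (t + 1) (s t) = 0))
    {Y : Fin 2 → ℝ} (hY : ∀ i, Y i ∈ Set.Icc 0 B) (hYR : ∀ i, Φ i (Y i) (Y i.rev) = R i) :
    ∃ T, ∀ t ≥ T, Φ (s t) (X (t + 1) (s t)) (X t (s t).rev) = R (s t) := by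
  by_cases hall : ∀ t, Φ (s t) (X (t + 1) (s t)) (X t (s t).rev) = R (s t)
  · exact ⟨0, fun t _ => hall t⟩
  push Not at hall
  obtain ⟨t₀, ht₀⟩ := hall
  have hB : B ∈ Set.Icc 0 B := ⟨(hX 0 0).1.trans (hX 0 0).2, le_rfl⟩
  -- an update against a small opponent is feasible and stays small
  have hgood : ∀ t, X t (s t).rev ≤ Y (s t).rev →
      Φ (s t) (X (t + 1) (s t)) (X t (s t).rev) = R (s t) ∧ X (t + 1) (s t) ≤ Y (s t) := by
    intro t h
    have h1 : R (s t) ≤ Φ (s t) (Y (s t)) (X t (s t).rev) := (hYR (s t)).symm.trans_le (hanti _ _ h)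
    have h2 : Φ (s t) (Y (s t)) (X t (s t).rev) ≤ Φ (s t) B (X t (s t).rev) :=
      (hmono _ _).monotoneOn (hY _) hB (hY _).2
    have h3 := (hupd t).resolve_right fun h => by linarith [h.1]
    exact ⟨h3, ((hmono _ _).le_iff_le (hX _ _) (hY _)).1 (h3.trans_le h1)⟩
  have hlow : ∀ t, X t ≤ Y → X (t + 1) ≤ Y := by
    intro t h
    refine (Fin.forall_two_iff (s t)).2 ⟨(hgood t (h _)).2, ?_⟩
    rw [hkeep]; exact h _
  set i := s t₀ with hi
  have hinv : ∀ t, t₀ + 1 ≤ t →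
      X t ≤ Y ∨ ((∀ r, t₀ + 1 ≤ r → r < t → s r = i) ∧ X t i = 0 ∧ Φ i B (X t i.rev) < R i) := by
    intro t ht
    induction t, ht using Nat.le_induction with
    | base =>
      obtain ⟨h1, h2⟩ := (hupd t₀).resolve_left ht₀
      exact Or.inr ⟨fun r _ _ => by omega, h2, by rw [hkeep]; exact h1⟩
    | succ t ht ih =>
      rcases ih with ih | ⟨h1, h2, h3⟩
      · exact Or.inl (hlow t ih)
      rcases Fin.eq_or_eq_rev i (s t) with h | h
      · right
        have hk := hkeep t
        have hu := hupd t
        rw [h] at hk hu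
        refine ⟨fun r hr hr' => ?_, ?_, by rw [hk]; exact h3⟩
        · rcases Nat.lt_succ_iff_lt_or_eq.1 hr' with h' | rfl
          exacts [h1 r hr h', h]
        · refine (hu.resolve_left fun h => ?_).2
          have := (hmono i (X t i.rev)).monotoneOn (hX (t + 1) i) hB (hX _ _).2
          linarith
      · left
        have hk := hkeep t
        have hg := hgood t
        rw [h, Fin.rev_rev] at hk hg
        refine (Fin.forall_two_iff i).2 ⟨?_, (hg ?_).2⟩
        · rw [hk, h2]; exact (hY i).1
        · rw [h2]; exact (hY i).1
  obtain ⟨t₁, ht₁, hst₁⟩ := hs i.rev (t₀ + 1)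
  have hstart : X (t₁ + 1) ≤ Y := by
    refine (hinv (t₁ + 1) (by omega)).resolve_right fun h => ?_
    have := (h.1 t₁ ht₁ (by omega)).symm.trans hst₁
    generalize i = j at this
    fin_cases j <;> simp at this
  refine ⟨t₁ + 1, fun t ht => (hgood t ?_).1⟩
  suffices X t ≤ Y from this _
  induction t, ht using Nat.le_induction with
  | base => exact hstart
  | succ t _ ih => exact hlow t ih

/-- If every update achieves its target, the amounts are monotone or antitone from the first
update on. -/
theorem eventually_monotone_or_antitone
    (hmono : ∀ i y, StrictMonoOn (Φ i · y) (Set.Icc 0 B))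
    (hanti : ∀ i x, Antitone (Φ i x))
    (hX : ∀ t i, X t i ∈ Set.Icc 0 B)
    (hkeep : ∀ t, X (t + 1) (s t).rev = X t (s t).rev)
    (hupd : ∀ t, Φ (s t) (X (t + 1) (s t)) (X t (s t).rev) = R (s t)) :
    (Monotone fun t => X (t + 1)) ∨ (Antitone fun t => X (t + 1)) := by
  have hfst : Φ (s 0) (X 1 (s 0)) (X 1 (s 0).rev) = R (s 0) := by
    rw [hkeep 0]; exact hupd 0
  rcases le_total (Φ (s 0).rev (X 1 (s 0).rev) (X 1 (s 0))) (R (s 0).rev) with h | h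
  · left
    have step : ∀ t, (∀ i, Φ i (X t i) (X t i.rev) ≤ R i) →
        X t ≤ X (t + 1) ∧ ∀ i, Φ i (X (t + 1) i) (X (t + 1) i.rev) ≤ R i := by
      intro t ht
      have h1 : X t (s t) ≤ X (t + 1) (s t) :=
        ((hmono _ (X t (s t).rev)).le_iff_le (hX _ _) (hX _ _)).1 ((ht _).trans_eq (hupd t).symm)
      refine ⟨(Fin.forall_two_iff (s t)).2 ⟨h1, (hkeep t).ge⟩,
        (Fin.forall_two_iff (s t)).2 ⟨?_, ?_⟩⟩
      · rw [hkeep]; exact (hupd t).le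
      · rw [hkeep, Fin.rev_rev]
        refine (hanti _ _ h1).trans ?_
        simpa using ht (s t).rev
    have hinv : ∀ t, ∀ i, Φ i (X (t + 1) i) (X (t + 1) i.rev) ≤ R i := by
      intro t
      induction t with
      | zero => exact (Fin.forall_two_iff (s 0)).2 ⟨hfst.le, by simpa using h⟩
      | succ t ih => exact (step _ ih).2
    exact monotone_nat_of_le_succ fun t => (step _ (hinv t)).1
  · right
    have step : ∀ t, (∀ i, R i ≤ Φ i (X t i) (X t i.rev)) →
        X (t + 1) ≤ X t ∧ ∀ i, R i ≤ Φ i (X (t + 1) i) (X (t + 1) i.rev) := by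
      intro t ht
      have h1 : X (t + 1) (s t) ≤ X t (s t) :=
        ((hmono _ (X t (s t).rev)).le_iff_le (hX _ _) (hX _ _)).1 ((hupd t).trans_le (ht _))
      refine ⟨(Fin.forall_two_iff (s t)).2 ⟨h1, (hkeep t).le⟩,
        (Fin.forall_two_iff (s t)).2 ⟨?_, ?_⟩⟩
      · rw [hkeep]; exact (hupd t).ge
      · rw [hkeep, Fin.rev_rev]
        refine le_trans ?_ (hanti _ _ h1)
        simpa using ht (s t).rev
    have hinv : ∀ t, ∀ i, R i ≤ Φ i (X (t + 1) i) (X (t + 1) i.rev) := by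
      intro t
      induction t with
      | zero => exact (Fin.forall_two_iff (s 0)).2 ⟨hfst.ge, by simpa using h⟩
      | succ t ih => exact (step _ ih).2
    exact antitone_nat_of_succ_le fun t => (step _ (hinv t)).1

end Dynamics

/-- Coarse allocations that respond to one another by sorting are eventually constant. -/
theorem eventually_const_of_sorted_responses {M : ℕ} {s : ℕ → Fin 2} {c : ℕ → Fin 2 → Fin M → ℕ}
    (hkeep : ∀ t, c (t + 1) (s t).rev = c t (s t).rev)
    (hsort : ∀ t, ∃ σ : Equiv.Perm (Fin M),
      (∀ l l', l < l' → c t (s t).rev (σ l) < c t (s t).rev (σ l') ∨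
        (c t (s t).rev (σ l) = c t (s t).rev (σ l') ∧ σ l < σ l')) ∧
      Antitone (c (t + 1) (s t) ∘ σ))
    (hperm : ∀ t, ∃ π : Equiv.Perm (Fin M), c t (s t) = c (t + 1) (s t) ∘ π) :
    ∃ T, ∀ t ≥ T, c t = c T := by
  let Ψ : ℕ → ℕ := fun t => ∑ m, (c t 0 m * c t 1 m * M + m.val * (c t 0 m + c t 1 m))
  have hΨ : ∀ t i, Ψ t = ∑ m, c t i m * (M * c t i.rev m + m.val) + ∑ m, m.val * c t i.rev m := by
    intro t i
    rw [← sum_add_distrib]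
    refine sum_congr rfl fun m _ => ?_
    fin_cases i <;> simp <;> ring
  have key : ∀ t, Ψ (t + 1) ≤ Ψ t ∧ (Ψ (t + 1) = Ψ t → c (t + 1) = c t) := by
    intro t
    obtain ⟨σ, hσ, hanti⟩ := hsort t
    obtain ⟨π, hπ⟩ := hperm t
    rw [hΨ (t + 1) (s t), hΨ t (s t), hkeep t, add_le_add_iff_right, Nat.add_right_cancel_iff]
    set w : Fin M → ℕ := fun m => M * c t (s t).rev m + m.val with hw
    have hmono : StrictMono (w ∘ σ) := by
      intro l l' h
      simp only [hw, Function.comp]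
      rcases hσ l l' h with h | ⟨h, h'⟩
      · have := (σ l).2
        have := Nat.mul_le_mul_left M (Nat.succ_le_of_lt h)
        rw [Nat.mul_succ] at this
        omega
      · rw [h]; simpa using h'
    have hav : Antivary (c (t + 1) (s t)) w := by
      intro a b hab
      have := hanti (a := σ.symm a) (b := σ.symm b)
        (hmono.lt_iff_lt.1 (by simpa using hab)).le
      simpa using this
    rw [hπ]
    refine ⟨by simpa using hav.sum_mul_le_sum_comp_perm_mul (σ := π), fun heq => ?_⟩
    have hav' : Antivary (c (t + 1) (s t) ∘ π) w :=
      hav.sum_comp_perm_mul_eq_sum_mul_iff.1 heq.symm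
    have hanti' : Antitone (c (t + 1) (s t) ∘ π ∘ σ) := by
      intro l l' h
      rcases h.eq_or_lt with rfl | h
      · exact le_rfl
      · exact hav' (hmono h)
    have h1 : c (t + 1) (s t) ∘ σ = c (t + 1) (s t) ∘ π ∘ σ :=
      Tuple.unique_antitone (σ := σ) (τ := σ.trans π) hanti hanti'
    refine funext ((Fin.forall_two_iff (s t)).2 ⟨?_, hkeep t⟩)
    rw [hπ]
    ext m
    simpa using congrFun h1 (σ.symm m)
  have hΨanti : Antitone Ψ := antitone_nat_of_succ_le fun t => (key t).1
  obtain ⟨T, hT⟩ := eventually_const_of_monotone_or_antitone (v := fun t => (Ψ t : ℤ))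
    (a := 0) (b := Ψ 0)
    (fun t => ⟨by positivity, Int.ofNat_le.2 (hΨanti (Nat.zero_le t))⟩)
    (Or.inr fun a b h => Int.ofNat_le.2 (hΨanti h))
  refine ⟨T, fun t ht => ?_⟩
  induction t, ht using Nat.le_induction with
  | base => rfl
  | succ t ht ih =>
    have h1 := hT (t + 1) (by omega)
    have h2 := hT t ht
    exact ((key t).2 (by omega)).trans ih

section Rate

variable {M : ℕ} {f : ℝ → ℝ} {g : Fin 2 → Fin 2 → ℝ} {N0 P : ℝ}

theorem sum_interference (i : Fin 2) (h : Fin 2 → ℝ) : ∑ j ∈ univ \ {i}, h j = h i.rev := by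
  have : (univ \ {i} : Finset (Fin 2)) = {i.rev} := by fin_cases i <;> rfl
  rw [this, sum_singleton]

/-- The rate of link `i` when it packs amount `x` from one end of the frame and the other link
packs amount `y` from the opposite end. -/
noncomputable def packedRate (M : ℕ) (f : ℝ → ℝ) (g : Fin 2 → Fin 2 → ℝ) (N0 P : ℝ)
    (i : Fin 2) (x y : ℝ) : ℝ :=
  (1 / (M : ℝ)) * ∑ k : Fin M,
    f (g i i * packed M P x k / (N0 + g i.rev i * packed M P y k.rev))

theorem mean_eq_packedRate {q a : Fin M → ℝ} {σ : Equiv.Perm (Fin M)} {x y : ℝ} (i : Fin 2)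
    (hq : q ∘ σ = packed M P x) (ha : a ∘ σ = packed M P y ∘ Fin.rev) :
    (1 / (M : ℝ)) * ∑ m, f (g i i * q m / (N0 + g i.rev i * a m)) =
      packedRate M f g N0 P i x y := by
  rw [packedRate, ← Equiv.sum_comp σ]
  congr 1
  refine sum_congr rfl fun k _ => ?_
  have h1 : q (σ k) = _ := congrFun hq k
  have h2 : a (σ k) = _ := congrFun ha k
  rw [h1, h2]; rfl

theorem frameRate_eq_packedRate {q : Fin 2 → Fin M → ℝ} {σ : Equiv.Perm (Fin M)} {x y : ℝ}
    {i : Fin 2} (hq : q i ∘ σ = packed M P x) (ha : q i.rev ∘ σ = packed M P y ∘ Fin.rev) :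
    frameRate f g N0 q i = packedRate M f g N0 P i x y := by
  rw [← mean_eq_packedRate i hq ha, frameRate]
  simp only [sum_interference]

theorem interference_pos (hg : ∀ i j, 0 < g i j) (hN0 : 0 < N0) (hP : 0 < P)
    (i : Fin 2) (y : ℝ) (k : Fin M) : 0 < N0 + g i.rev i * packed M P y k :=
  add_pos_of_pos_of_nonneg hN0 (mul_nonneg (hg _ _).le (packed_nonneg hP.le _ _))

theorem snr_nonneg (hg : ∀ i j, 0 < g i j) (hN0 : 0 < N0) (hP : 0 < P)
    (i : Fin 2) (x y : ℝ) (k l : Fin M) :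
    0 ≤ g i i * packed M P x k / (N0 + g i.rev i * packed M P y l) :=
  div_nonneg (mul_nonneg (hg _ _).le (packed_nonneg hP.le _ _))
    (interference_pos hg hN0 hP i y l).le

theorem strictMonoOn_packedRate (hM : 1 ≤ M) (hg : ∀ i j, 0 < g i j) (hN0 : 0 < N0) (hP : 0 < P)
    (hf : StrictMonoOn f (Set.Ici 0)) (i : Fin 2) (y : ℝ) :
    StrictMonoOn (packedRate M f g N0 P i · y) (Set.Icc 0 (M : ℝ)) := by
  intro x hx x' hx' hlt
  have hM0 : (0 : ℝ) < M := by exact_mod_cast hM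
  have hsum : ∑ k, packed M P x k < ∑ k, packed M P x' k := by
    rw [sum_packed hx, sum_packed hx']
    exact mul_lt_mul_of_pos_left hlt hP
  obtain ⟨k, -, hk⟩ := exists_lt_of_sum_lt hsum
  refine mul_lt_mul_of_pos_left (sum_lt_sum (fun l _ => ?_) ⟨k, mem_univ _, ?_⟩) (by positivity)
  · refine hf.monotoneOn (snr_nonneg hg hN0 hP ..) (snr_nonneg hg hN0 hP ..) ?_
    exact div_le_div_of_nonneg_right
      (mul_le_mul_of_nonneg_left (packed_mono hP.le hlt.le l) (hg _ _).le)
      (interference_pos hg hN0 hP ..).le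
  · refine hf (snr_nonneg hg hN0 hP ..) (snr_nonneg hg hN0 hP ..) ?_
    exact div_lt_div_of_pos_right (mul_lt_mul_of_pos_left hk (hg _ _))
      (interference_pos hg hN0 hP ..)

theorem antitone_packedRate (hg : ∀ i j, 0 < g i j) (hN0 : 0 < N0) (hP : 0 < P)
    (hf : StrictMonoOn f (Set.Ici 0)) (i : Fin 2) (x : ℝ) :
    Antitone (packedRate M f g N0 P i x) := by
  intro y y' h
  refine mul_le_mul_of_nonneg_left (sum_le_sum fun k _ => ?_) (by positivity)
  refine hf.monotoneOn (snr_nonneg hg hN0 hP ..) (snr_nonneg hg hN0 hP ..) ?_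
  exact div_le_div_of_nonneg_left (mul_nonneg (hg _ _).le (packed_nonneg hP.le _ _))
    (interference_pos hg hN0 hP ..)
    (by gcongr; exacts [(hg _ _).le, packed_mono hP.le h _])

theorem continuous_packedRate (hg : ∀ i j, 0 < g i j) (hN0 : 0 < N0) (hP : 0 < P)
    (hf : ContinuousOn f (Set.Ici 0)) (i : Fin 2) :
    Continuous fun z : ℝ × ℝ => packedRate M f g N0 P i z.1 z.2 := by
  refine continuous_const.mul (continuous_finsetSum _ fun k _ => ?_)
  refine hf.comp_continuous ?_ fun z => snr_nonneg hg hN0 hP ..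
  refine Continuous.div ?_ ?_ fun z => (interference_pos hg hN0 hP ..).ne'
  · exact continuous_const.mul ((continuous_packed k).comp continuous_fst)
  · exact continuous_const.add
      (continuous_const.mul ((continuous_packed k.rev).comp continuous_snd))

end Rate

section Opposed

variable {M : ℕ} {P : ℝ}

/-- After a common reordering of the slots, links `i` and `i.rev` pack amounts `x i` and `x i.rev`
from opposite ends of the frame. -/
def Opposed (P : ℝ) (a : Fin 2 → Fin M → ℝ) (x : Fin 2 → ℝ) (i : Fin 2) : Prop :=
  ∃ σ : Equiv.Perm (Fin M),
    a i ∘ σ = packed M P (x i) ∧ a i.rev ∘ σ = packed M P (x i.rev) ∘ Fin.rev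

theorem Opposed.rev {a : Fin 2 → Fin M → ℝ} {x : Fin 2 → ℝ} {i : Fin 2} (h : Opposed P a x i) :
    Opposed P a x i.rev := by
  obtain ⟨σ, h1, h2⟩ := h
  refine ⟨Fin.revPerm.trans σ, ?_, ?_⟩
  · ext k; simpa using congrFun h2 k.rev
  · ext k; simpa using congrFun h1 k.rev

theorem Opposed.of_opposed {a : Fin 2 → Fin M → ℝ} {x : Fin 2 → ℝ} {i : Fin 2}
    (h : Opposed P a x i) (j : Fin 2) : Opposed P a x j := by
  rcases Fin.eq_or_eq_rev i j with rfl | rfl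
  exacts [h, h.rev]

theorem Repulsive.exists_opposed (hP : 0 < P) {q : Fin 2 → Fin M → ℝ}
    (hq : ∀ i m, q i m ∈ Set.Icc 0 P) (h : Repulsive P q) :
    ∃ x : Fin 2 → ℝ, (∀ i, x i ∈ Set.Icc 0 (M : ℝ)) ∧ Opposed P q x 0 := by
  obtain ⟨σ, m₁, m₂, -, -, h⟩ := h
  obtain ⟨x, hx, hqx⟩ := exists_eq_packed hP (a := q 0 ∘ σ) m₁
    (fun m hm => (h m).1 hm) (fun m hm => (h m).2.1 (by omega)) (fun m => hq _ _)
  obtain ⟨y, hy, hqy⟩ := exists_eq_packed hP (a := q 1 ∘ σ ∘ Fin.rev) (M + 1 - m₂)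
    (fun m hm => (h m.rev).2.2.1 (by rw [Fin.val_rev]; omega))
    (fun m hm => (h m.rev).2.2.2 (by rw [Fin.val_rev]; omega)) (fun m => hq _ _)
  refine ⟨![x, y], fun i => by fin_cases i <;> assumption, σ, hqx, ?_⟩
  ext k
  simpa using congrFun hqy k.rev

theorem Opposed.repulsive {a : Fin 2 → Fin M → ℝ} {x : Fin 2 → ℝ}
    (hx : ∀ i, x i ∈ Set.Icc 0 (M : ℝ)) (h : Opposed P a x 0) : Repulsive P a := by
  obtain ⟨σ, h1, h2⟩ := h
  have hfl : ∀ i, ⌊x i⌋₊ ≤ M := fun i => Nat.floor_le_of_le (hx i).2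
  have hle : ∀ i (k : Fin M), k.val + 1 ≤ ⌊x i⌋₊ → packed M P (x i) k = P := by
    intro i k hk
    have := (Nat.le_floor_iff (hx i).1).1 hk
    rw [packed, ramp_eq_one (by exact_mod_cast this), mul_one]
  have hlt : ∀ i (k : Fin M), ⌊x i⌋₊ < k.val → packed M P (x i) k = 0 := by
    intro i k hk
    rw [packed, ramp_eq_zero ((Nat.floor_lt (hx i).1).1 hk).le, mul_zero]
  refine ⟨σ, ⌊x 0⌋₊, M + 1 - ⌊x 1⌋₊, (hfl 0).trans (by omega), by omega, fun m => ?_⟩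
  have e1 : a 0 (σ m) = packed M P (x 0) m := congrFun h1 m
  have e2 : a 1 (σ m) = packed M P (x 1) m.rev := congrFun h2 m
  have := hfl 1
  rw [e1, e2]
  refine ⟨fun h => hle 0 m h, fun h => hlt 0 m (by omega), fun h => hle 1 _ ?_,
    fun h => hlt 1 _ ?_⟩ <;> rw [Fin.val_rev] <;> omega

end Opposed

/-- A Power Packing response is either silence against an infeasible target, or a packed
allocation in interference order that achieves the target. -/
theorem IsPPResponse.silent_or_packed {M : ℕ} {f : ℝ → ℝ} {γ P R : ℝ} {I q : Fin M → ℝ} (hP : 0 < P)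
    (h : IsPPResponse f γ P R I q) :
    ((1 / (M : ℝ)) * ∑ m, f (γ * P / I m) < R ∧ q = 0) ∨
    ∃ x ∈ Set.Icc 0 (M : ℝ), ∃ σ : Equiv.Perm (Fin M), q ∘ σ = packed M P x ∧
      (∀ l l', l < l' → I (σ l) < I (σ l') ∨ (I (σ l) = I (σ l') ∧ σ l < σ l')) ∧
      (1 / (M : ℝ)) * ∑ m, f (γ * q m / I m) = R := by
  rcases lt_or_ge ((1 / (M : ℝ)) * ∑ m, f (γ * P / I m)) R with hlt | hge
  · exact Or.inl ⟨hlt, h.1 hlt⟩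
  obtain ⟨σ, hσ, mt, -, hfull, hzero, hpart, hR⟩ := h.2 hge
  obtain ⟨x, hx, hqx⟩ := exists_eq_packed hP (a := q ∘ σ) (mt - 1)
    (fun m hm => hfull m (by omega)) (fun m hm => hzero m (by omega)) (fun m => by
      rcases lt_trichotomy (m.val + 1) mt with h | h | h
      · simp [hfull m h, hP.le]
      · exact hpart m h
      · simp [hzero m h, hP.le])
  exact Or.inr ⟨x, hx, σ, hqx, hσ, hR⟩

/-- The number of slots that could be filled with the total power of an allocation. -/
noncomputable def amount {M : ℕ} (P : ℝ) (q : Fin M → ℝ) : ℝ := (∑ m, q m) / P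

/-- Up to the order of the slots, the allocation is full, then partial in one slot, then silent. -/
def IsPacked {M : ℕ} (P : ℝ) (q : Fin M → ℝ) : Prop :=
  amount P q ∈ Set.Icc 0 (M : ℝ) ∧ ∃ β : Equiv.Perm (Fin M), q = packed M P (amount P q) ∘ β

theorem amount_eq {M : ℕ} {P x : ℝ} {q : Fin M → ℝ} {σ : Equiv.Perm (Fin M)} (hP : 0 < P)
    (hx : x ∈ Set.Icc 0 (M : ℝ)) (h : q ∘ σ = packed M P x) : amount P q = x := by
  have : ∑ m, q m = P * x := by
    rw [← sum_packed hx, ← h, ← Equiv.sum_comp σ]; rfl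
  rw [amount, this, mul_div_cancel_left₀ _ hP.ne']

theorem isPacked_of_comp_eq {M : ℕ} {P x : ℝ} {q : Fin M → ℝ} {σ : Equiv.Perm (Fin M)}
    (hP : 0 < P) (hx : x ∈ Set.Icc 0 (M : ℝ)) (h : q ∘ σ = packed M P x) : IsPacked P q := by
  rw [IsPacked, amount_eq hP hx h]
  exact ⟨hx, σ.symm, by rw [← h]; ext; simp⟩

theorem IsPPResponse.isPacked {M : ℕ} {f : ℝ → ℝ} {γ P R : ℝ} {I q : Fin M → ℝ} (hP : 0 < P)
    (h : IsPPResponse f γ P R I q) : IsPacked P q := by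
  rcases h.silent_or_packed hP with ⟨-, rfl⟩ | ⟨x, hx, σ, h, -⟩
  · exact isPacked_of_comp_eq (σ := Equiv.refl _) hP (x := 0) ⟨le_rfl, by positivity⟩
      (by rw [packed_zero]; rfl)
  · exact isPacked_of_comp_eq hP hx h

theorem IsPacked.powerClass_lt {M : ℕ} {P : ℝ} {q : Fin M → ℝ} (hP : 0 < P) (h : IsPacked P q)
    {k l : Fin M} (hkl : q k < q l) : powerClass P (q k) < powerClass P (q l) := by
  obtain ⟨-, β, hβ⟩ := h
  refine (powerClass_mono P hkl.le).lt_of_ne fun heq => hkl.ne ?_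
  rw [hβ] at heq ⊢
  exact packed_eq_of_powerClass_eq hP heq

/-- Sorting the slots by increasing power turns a packed allocation into a reversed one. -/
theorem IsPacked.comp_eq_rev {M : ℕ} {P : ℝ} {q : Fin M → ℝ} (hP : 0 < P) (h : IsPacked P q)
    {σ : Equiv.Perm (Fin M)} (hσ : Monotone (q ∘ σ)) :
    q ∘ σ = packed M P (amount P q) ∘ Fin.rev := by
  obtain ⟨-, β, hβ⟩ := h
  have h1 : Monotone (packed M P (amount P q) ∘ (σ.trans β)) := by
    rw [hβ] at hσ
    exact hσ
  have h2 : Monotone (packed M P (amount P q) ∘ (Fin.revPerm : Equiv.Perm (Fin M))) :=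
    fun k l hkl => packed_anti hP.le _ (Fin.rev_le_rev.2 hkl)
  have := Tuple.unique_monotone h1 h2
  conv_lhs => rw [hβ]
  exact this

/-- A packed allocation is determined by its amount and its power classes. -/
theorem IsPacked.eq_packed_comp {M : ℕ} {P x : ℝ} {q : Fin M → ℝ} {β : Equiv.Perm (Fin M)}
    (hP : 0 < P) (h : IsPacked P q) (hfloor : ⌊amount P q⌋ = ⌊x⌋) (hceil : ⌈amount P q⌉ = ⌈x⌉)
    (hclass : ∀ m, powerClass P (q m) = powerClass P (packed M P x (β m))) :
    q = packed M P (amount P q) ∘ β := by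
  obtain ⟨-, β', hβ'⟩ := h
  have : ∀ k : Fin M, powerClass P (packed M P x k) =
      powerClass P (packed M P (amount P q) k) := by
    intro k
    rw [powerClass_packed hP, powerClass_packed hP, hfloor, hceil]
  ext m
  have hm : q m = packed M P (amount P q) (β' m) := congrFun hβ' m
  rw [Function.comp, hm]
  refine packed_eq_of_powerClass_eq hP ?_
  rw [← hm, hclass, this]

/-- The two alternatives for a response to a packed allocation, in terms of the amounts. -/
theorem IsPPResponse.amount_cases {M : ℕ} {f : ℝ → ℝ} {g : Fin 2 → Fin 2 → ℝ} {N0 P R : ℝ}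
    {i : Fin 2} {q b : Fin M → ℝ} (hg : ∀ i j, 0 < g i j) (hP : 0 < P) (hb : IsPacked P b)
    (h : IsPPResponse f (g i i) P R (fun m => N0 + g i.rev i * b m) q) :
    (packedRate M f g N0 P i M (amount P b) < R ∧ amount P q = 0) ∨
    (packedRate M f g N0 P i (amount P q) (amount P b) = R ∧
      ∃ σ : Equiv.Perm (Fin M), q ∘ σ = packed M P (amount P q) ∧
        b ∘ σ = packed M P (amount P b) ∘ Fin.rev ∧
        ∀ l l', l < l' → b (σ l) < b (σ l') ∨ (b (σ l) = b (σ l') ∧ σ l < σ l')) := by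
  rcases h.silent_or_packed hP with ⟨hlt, rfl⟩ | ⟨x, hx, σ, hq, hσ, hR⟩
  · refine Or.inl ⟨?_, by simp [amount]⟩
    obtain ⟨-, β, hβ⟩ := hb
    rw [← mean_eq_packedRate (q := fun _ => P) (a := b)
      (σ := (Fin.revPerm : Equiv.Perm (Fin M)).trans β.symm) i]
    · exact hlt
    · ext k; exact (packed_full k).symm
    · ext k
      conv_lhs => rw [hβ]
      simp
  · have hsort : ∀ l l', l < l' → b (σ l) < b (σ l') ∨ (b (σ l) = b (σ l') ∧ σ l < σ l') := by
      intro l l' hl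
      simpa [(hg _ _).ne', mul_lt_mul_iff_right₀ (hg i.rev i)] using hσ l l' hl
    have hmono : Monotone (b ∘ σ) := by
      intro l l' hl
      rcases hl.eq_or_lt with rfl | hl
      · exact le_rfl
      · exact (hsort l l' hl).elim le_of_lt fun h => h.1.le
    have hb' := hb.comp_eq_rev hP hmono
    rw [amount_eq hP hx hq]
    exact Or.inr ⟨by rw [← mean_eq_packedRate i hq hb']; exact hR, σ, hq, hb', hsort⟩

/-- Iterated Power Packing from packed allocations converges if the target is achieved by
opposed allocations. -/
theorem exists_tendsto_opposed {M : ℕ} {f : ℝ → ℝ} {g : Fin 2 → Fin 2 → ℝ} {N0 P : ℝ}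
    (hM : 1 ≤ M) (hg : ∀ i j, 0 < g i j) (hN0 : 0 < N0) (hP : 0 < P)
    (hf_cont : ContinuousOn f (Set.Ici 0)) (hf_mono : StrictMonoOn f (Set.Ici 0))
    {s : ℕ → Fin 2} (hs : ∀ i t, ∃ t', t ≤ t' ∧ s t' = i) {R : Fin 2 → ℝ}
    {a : ℕ → Fin 2 → Fin M → ℝ} (hpacked : ∀ t i, IsPacked P (a t i))
    (hkeep : ∀ t, a (t + 1) (s t).rev = a t (s t).rev)
    (hresp : ∀ t, IsPPResponse f (g (s t) (s t)) P (R (s t))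
      (fun m => N0 + g (s t).rev (s t) * a t (s t).rev m) (a (t + 1) (s t)))
    {y : Fin 2 → ℝ} (hy : ∀ i, y i ∈ Set.Icc 0 (M : ℝ))
    (hyR : ∀ i, packedRate M f g N0 P i (y i) (y i.rev) = R i) :
    ∃ (b : Fin 2 → Fin M → ℝ) (x : Fin 2 → ℝ), (∀ i, x i ∈ Set.Icc 0 (M : ℝ)) ∧
      (∀ i, Opposed P b x i) ∧ (∀ i, packedRate M f g N0 P i (x i) (x i.rev) = R i) ∧
      Filter.Tendsto a Filter.atTop (nhds b) := by
  have hΦmono := strictMonoOn_packedRate hM hg hN0 hP hf_mono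
  have hΦanti := antitone_packedRate (M := M) hg hN0 hP hf_mono
  set X : ℕ → Fin 2 → ℝ := fun t i => amount P (a t i) with hXdef
  have hX : ∀ t i, X t i ∈ Set.Icc 0 (M : ℝ) := fun t i => (hpacked t i).1
  have hXkeep : ∀ t, X (t + 1) (s t).rev = X t (s t).rev := fun t => by
    simp only [hXdef, hkeep]
  have hcases := fun t => (hresp t).amount_cases hg hP (hpacked t _)
  obtain ⟨T₁, hT₁⟩ := eventually_target_achieved hΦmono hΦanti hs hX hXkeep
    (fun t => (hcases t).symm.imp_left And.left) hy hyR
  have hM0 : (M : ℝ) ∈ Set.Icc 0 (M : ℝ) := ⟨by positivity, le_rfl⟩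
  have hsorted : ∀ t ≥ T₁, ∃ σ : Equiv.Perm (Fin M),
      a (t + 1) (s t) ∘ σ = packed M P (X (t + 1) (s t)) ∧
      a t (s t).rev ∘ σ = packed M P (X t (s t).rev) ∘ Fin.rev ∧
      ∀ l l', l < l' → a t (s t).rev (σ l) < a t (s t).rev (σ l') ∨
        (a t (s t).rev (σ l) = a t (s t).rev (σ l') ∧ σ l < σ l') := by
    intro t ht
    refine ((hcases t).resolve_left fun h => ?_).2
    have h1 := (hΦmono (s t) (X t (s t).rev)).monotoneOn (hX (t + 1) (s t)) hM0 (hX _ _).2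
    have h2 := hT₁ t ht
    have h3 := h.1
    simp only [hXdef] at h1 h2
    linarith
  -- the amounts are eventually monotone
  set Z : ℕ → Fin 2 → ℝ := fun t => X (t + 1 + T₁) with hZdef
  have hZmono : Monotone Z ∨ Antitone Z :=
    eventually_monotone_or_antitone (X := fun t => X (t + T₁)) (s := fun t => s (t + T₁))
      hΦmono hΦanti (fun t => hX _)
      (fun t => by rw [add_right_comm]; exact hXkeep _)
      (fun t => by rw [add_right_comm]; exact hT₁ _ (by omega))
  have hlim : ∀ i, ∃ L, Filter.Tendsto (fun t => X t i) Filter.atTop (nhds L) := by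
    intro i
    suffices ∃ L, Filter.Tendsto (fun t => Z t i) Filter.atTop (nhds L) by
      obtain ⟨L, hL⟩ := this
      exact ⟨L, (Filter.tendsto_add_atTop_iff_nat (f := fun t => X t i) (1 + T₁)).1
        (by simpa only [hZdef, add_assoc] using hL)⟩
    rcases hZmono with h | h
    · exact ⟨_, tendsto_atTop_ciSup (fun t u htu => h htu i)
        ⟨(M : ℝ), by rintro _ ⟨t, rfl⟩; exact (hX _ i).2⟩⟩
    · exact ⟨_, tendsto_atTop_ciInf (fun t u htu => h htu i)
        ⟨(0 : ℝ), by rintro _ ⟨t, rfl⟩; exact (hX _ i).1⟩⟩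
  choose x hx using hlim
  have hround : ∀ r : ℝ → ℤ, Monotone r →
      ∃ T, ∀ i, ∀ t ≥ T, r (X t i) = r (X T i) := by
    intro r hr
    have : ∀ i, ∃ T, ∀ t ≥ T, r (Z t i) = r (Z T i) := fun i =>
      eventually_const_of_monotone_or_antitone (a := r 0) (b := r M)
        (fun t => ⟨hr (hX _ _).1, hr (hX _ _).2⟩)
        (hZmono.imp (fun h t u htu => hr (h htu i)) fun h t u htu => hr (h htu i))
    choose T hT using this
    refine ⟨T 0 + T 1 + 1 + T₁, fun i t ht => ?_⟩
    obtain ⟨u, rfl⟩ := Nat.exists_eq_add_of_le ht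
    have hi : T i ≤ T 0 + T 1 := by fin_cases i <;> simp
    have h1 := hT i (T 0 + T 1 + u) (by omega)
    have h2 := hT i (T 0 + T 1) hi
    simp only [hZdef] at h1 h2
    rw [show T 0 + T 1 + 1 + T₁ + u = T 0 + T 1 + u + 1 + T₁ by omega, h1, h2]
  obtain ⟨Tf, hTf⟩ := hround Int.floor Int.floor_mono
  obtain ⟨Tc, hTc⟩ := hround Int.ceil Int.ceil_mono
  obtain ⟨T₂, h₁, h₂, h₃⟩ : ∃ T₂, T₁ ≤ T₂ ∧ Tf ≤ T₂ ∧ Tc ≤ T₂ :=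
    ⟨T₁ + Tf + Tc, by omega, by omega, by omega⟩
  have hround' : ∀ i, ∀ t ≥ T₂, ∀ u ≥ T₂, ⌊X t i⌋ = ⌊X u i⌋ ∧ ⌈X t i⌉ = ⌈X u i⌉ :=
    fun i t ht u hu => ⟨(hTf i t (by omega)).trans (hTf i u (by omega)).symm,
      (hTc i t (by omega)).trans (hTc i u (by omega)).symm⟩
  -- hence the power classes are eventually constant
  obtain ⟨T₃, hT₃⟩ := eventually_const_of_sorted_responses (s := fun t => s (t + T₂))
    (c := fun t i m => powerClass P (a (t + T₂) i m))
    (fun t => by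
      ext m
      rw [add_right_comm, hkeep])
    (fun t => by
      obtain ⟨σ, hσ, -, hsort⟩ := hsorted (t + T₂) (by omega)
      refine ⟨σ, fun l l' hl => ?_, fun l l' hl => ?_⟩
      · exact (hsort l l' hl).imp ((hpacked _ _).powerClass_lt hP) fun h => ⟨by rw [h.1], h.2⟩
      · refine powerClass_mono P ?_
        rw [add_right_comm]
        have h1 := congrFun hσ l
        have h2 := congrFun hσ l'
        simp only [Function.comp] at h1 h2
        rw [h1, h2]
        exact packed_anti hP.le _ hl)
    (fun t => by
      obtain ⟨-, β, hβ⟩ := hpacked (t + T₂) (s (t + T₂))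
      obtain ⟨-, β', hβ'⟩ := hpacked (t + 1 + T₂) (s (t + T₂))
      obtain ⟨hfl, hce⟩ := hround' (s (t + T₂)) (t + T₂) (by omega) (t + 1 + T₂) (by omega)
      refine ⟨β.trans β'.symm, funext fun m => ?_⟩
      have h1 := congrFun hβ m
      have h2 := congrFun hβ' (β'.symm (β m))
      simp only [Function.comp, Equiv.apply_symm_apply] at h1 h2
      simp only [Function.comp, Equiv.trans_apply]
      rw [h1, h2, powerClass_packed hP, powerClass_packed hP]
      simp only [hXdef] at hfl hce
      rw [hfl, hce])
  have hclass : ∀ i m, ∀ t ≥ T₃ + T₂, ∀ u ≥ T₃ + T₂,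
      powerClass P (a t i m) = powerClass P (a u i m) := by
    intro i m t ht u hu
    have h1 := congrFun (congrFun (hT₃ (t - T₂) (by omega)) i) m
    have h2 := congrFun (congrFun (hT₃ (u - T₂) (by omega)) i) m
    simp only [Nat.sub_add_cancel (show T₂ ≤ t by omega),
      Nat.sub_add_cancel (show T₂ ≤ u by omega)] at h1 h2
    exact h1.trans h2.symm
  have hstable : ∀ i, ∀ T ≥ T₃ + T₂, ∀ β : Equiv.Perm (Fin M), a T i = packed M P (X T i) ∘ β →
      Filter.Tendsto (fun t => a t i) Filter.atTop (nhds (packed M P (x i) ∘ β)) := by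
    intro i T hT β hβ
    rw [tendsto_pi_nhds]
    intro m
    refine Filter.Tendsto.congr' ?_ (((continuous_packed (P := P) (β m)).tendsto (x i)).comp (hx i))
    filter_upwards [Filter.eventually_ge_atTop (T₃ + T₂)] with t ht
    obtain ⟨hfl, hce⟩ := hround' i t (by omega) T (by omega)
    refine (congrFun ((hpacked t i).eq_packed_comp hP hfl hce fun m => ?_) m).symm
    rw [hclass i m t ht T hT, hβ]
    rfl
  set t := T₃ + T₂ with ht
  obtain ⟨σ, hσ, hσ', -⟩ := hsorted t (by omega)
  have e1 : a (t + 1) (s t) = packed M P (X (t + 1) (s t)) ∘ σ.symm := by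
    rw [← hσ]; ext; simp
  have e2 : a (t + 1) (s t).rev = packed M P (X (t + 1) (s t).rev) ∘
      (σ.symm.trans Fin.revPerm) := by
    rw [hkeep, hXkeep]
    ext m
    simpa using congrFun hσ' (σ.symm m)
  have l1 := hstable _ (t + 1) (by omega) _ e1
  have l2 := hstable _ (t + 1) (by omega) _ e2
  obtain ⟨b, hb⟩ : ∃ b, Filter.Tendsto a Filter.atTop (nhds b) := by
    refine ⟨fun i => if i = s t then packed M P (x i) ∘ σ.symm else
      packed M P (x i) ∘ (σ.symm.trans Fin.revPerm), tendsto_pi_nhds.2 ?_⟩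
    have hne : (s t).rev ≠ s t := by generalize s t = j; fin_cases j <;> simp
    exact (Fin.forall_two_iff (s t)).2 ⟨by simpa using l1, by simpa [hne] using l2⟩
  have hb' := tendsto_pi_nhds.1 hb
  have b1 := tendsto_nhds_unique (hb' _) l1
  have b2 := tendsto_nhds_unique (hb' _) l2
  refine ⟨b, x, fun i => isClosed_Icc.mem_of_tendsto (hx i)
      (Filter.Eventually.of_forall fun t => hX t i),
    Opposed.of_opposed (i := s t) ⟨σ, ?_, ?_⟩, fun i => ?_, hb⟩
  · rw [b1]; ext; simp
  · rw [b2]; ext; simp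
  · by_contra hne
    have hz : Filter.Tendsto (fun t => (X (t + 1) i, X (t + 1) i.rev)) Filter.atTop
        (nhds (x i, x i.rev)) :=
      Filter.Tendsto.prodMk_nhds ((Filter.tendsto_add_atTop_iff_nat 1).2 (hx i))
        ((Filter.tendsto_add_atTop_iff_nat 1).2 (hx i.rev))
    have h1 := ((continuous_packedRate (M := M) (P := P) hg hN0 hP hf_cont i).tendsto _).comp hz
    obtain ⟨T, hT⟩ := Filter.eventually_atTop.1 (h1.eventually_ne hne)
    obtain ⟨u, hu, rfl⟩ := hs i (T + T₁)
    refine hT u (by omega) ?_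
    simp only [Function.comp, hXkeep]
    exact hT₁ u (by omega)

/-- Theorem 1, continuous version: for two links, Iterative Power Packing,
started from any allocation and with an update sequence in which each link is
updated infinitely often, converges to a repulsive allocation achieving exactly
any target rate vector in `R_M^IPP`. -/
theorem iterative_power_packing_converges
    (M : ℕ) (hM : 1 ≤ M) (f : ℝ → ℝ) (g : Fin 2 → Fin 2 → ℝ) (N0 Pmax : ℝ)
    (hg : ∀ i j, 0 < g i j) (hN0 : 0 < N0) (hP : 0 < Pmax)
    (hf_cont : ContinuousOn f (Set.Ici 0)) (hf_mono : StrictMonoOn f (Set.Ici 0))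
    (hf_conc : ConcaveOn ℝ (Set.Ici 0) f) (hf0 : f 0 = 0)
    (hf_nonneg : ∀ x ∈ Set.Ici (0 : ℝ), 0 ≤ f x)
    (s : ℕ → Fin 2) (hs : ∀ i : Fin 2, ∀ t : ℕ, ∃ t', t ≤ t' ∧ s t' = i)
    (Rt : Fin 2 → ℝ)
    (p : ℕ → Fin 2 → Fin M → ℝ)
    (hp0 : ∀ i m, p 0 i m ∈ Set.Icc 0 Pmax)
    (hupd : ∀ t : ℕ, 1 ≤ t →
      (∀ j : Fin 2, j ≠ s t → p t j = p (t - 1) j) ∧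
      IsPPResponse f (g (s t) (s t)) Pmax (Rt (s t))
        (fun m => N0 + ∑ j ∈ univ \ {s t}, g j (s t) * p (t - 1) j m)
        (p t (s t)))
    (hfeas : ∃ q : Fin 2 → Fin M → ℝ,
      (∀ i m, q i m ∈ Set.Icc 0 Pmax) ∧ Repulsive Pmax q ∧
      ∀ i, frameRate f g N0 q i = Rt i) :
    ∃ plim : Fin 2 → Fin M → ℝ,
      (∀ i m, plim i m ∈ Set.Icc 0 Pmax) ∧
      Repulsive Pmax plim ∧
      (∀ i, frameRate f g N0 plim i = Rt i) ∧
      Filter.Tendsto p Filter.atTop (nhds plim) := by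
  obtain ⟨q, hq, hqrep, hqR⟩ := hfeas
  obtain ⟨y, hy, hopp⟩ := hqrep.exists_opposed hP hq
  have hyR : ∀ i, packedRate M f g N0 Pmax i (y i) (y i.rev) = Rt i := fun i => by
    obtain ⟨σ, h1, h2⟩ := hopp.of_opposed i
    rw [← hqR i, frameRate_eq_packedRate h1 h2]
  have hpacked : ∀ i, ∃ T, ∀ t ≥ T, IsPacked Pmax (p t i) := by
    intro i
    obtain ⟨T, hT, hsT⟩ := hs i 1
    refine ⟨T, fun t ht => ?_⟩
    induction t, ht using Nat.le_induction with
    | base => exact hsT ▸ (hupd T hT).2.isPacked hP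
    | succ t ht ih =>
      obtain ⟨h1, h2⟩ := hupd (t + 1) (by omega)
      by_cases h : i = s (t + 1)
      · exact h ▸ h2.isPacked hP
      · rw [h1 i h]; exact ih
  choose T hT using hpacked
  have hT' : ∀ i, T i ≤ T 0 + T 1 := fun i => by fin_cases i <;> simp
  have hne : ∀ i : Fin 2, i.rev ≠ i := by decide
  obtain ⟨b, x, hx, hbx, hxR, hlim⟩ := exists_tendsto_opposed hM hg hN0 hP hf_cont hf_mono
    (s := fun t => s (t + (T 0 + T 1) + 1)) (a := fun t => p (t + (T 0 + T 1))) (R := Rt)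
    (fun i t => by
      obtain ⟨u, hu, hsu⟩ := hs i (t + (T 0 + T 1) + 1)
      exact ⟨u - (T 0 + T 1) - 1, by omega, by rw [← hsu]; congr 1; omega⟩)
    (fun t i => hT i _ ((hT' i).trans (by omega)))
    (fun t => by
      rw [add_right_comm t 1]
      exact (hupd (t + (T 0 + T 1) + 1) (by omega)).1 _ (hne _))
    (fun t => by
      rw [add_right_comm t 1]
      simpa only [sum_interference, add_tsub_cancel_right] using
        (hupd (t + (T 0 + T 1) + 1) (by omega)).2)
    hy hyR
  refine ⟨b, fun i m => ?_, (hbx 0).repulsive hx, fun i => ?_,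
    (Filter.tendsto_add_atTop_iff_nat _).1 hlim⟩
  · obtain ⟨σ, h, -⟩ := hbx i
    have hm : b i m = packed M Pmax (x i) (σ.symm m) := by
      simpa using congrFun h (σ.symm m)
    rw [hm]
    exact ⟨packed_nonneg hP.le _ _, packed_le hP.le _ _⟩
  · obtain ⟨σ, h1, h2⟩ := hbx i
    rw [frameRate_eq_packedRate h1 h2, hxR]
end
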